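/- arXiv:math/0311473 — 4 statements merged into one kernel-verified Lean document; each statement's English description precedes it below -/
import Mathlib

section
/- Let E/F be a finite separable field extension of infinite fields of characteristic ≠ 2 and (V, q) a quadratic space over F. Then the norm of any element of E* represented by q_E = q ⊗_F E lies in the subgroup D_q(F) of F* generated by nonzero values of q (Knebusch's Norm Principle over fields). -/
open scoped TensorProduct

section
open Polynomial
variable {F : Type*} [Field F] {ι : Type*} [Fintype ι]

/-- membership of a field element in a subgroup of units -/
def InD (S : Subgroup Fˣ) (a : F) : Prop := ∃ u ∈ S, (u : F) = a

theorem InD.mul {S : Subgroup Fˣ} {a b : F} (ha : InD S a) (hb : InD S b) : InD S (a * b) := by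
  obtain ⟨u, hu, rfl⟩ := ha
  obtain ⟨v, hv, rfl⟩ := hb
  exact ⟨u * v, S.mul_mem hu hv, by simp⟩

theorem InD.of_mul {S : Subgroup Fˣ} {a b : F} (hab : InD S (a * b)) (hb : InD S b) : InD S a := by
  obtain ⟨u, hu, h⟩ := hab
  obtain ⟨v, hv, rfl⟩ := hb
  refine ⟨u * v⁻¹, S.mul_mem hu (S.inv_mem hv), ?_⟩
  simp [h]

theorem InD.one (S : Subgroup Fˣ) : InD S (1 : F) := ⟨1, S.one_mem, by simp⟩

theorem key (S : Subgroup Fˣ) (c : ι → F)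
    (hS : ∀ x : ι → F, ∑ i, c i * x i ^ 2 ≠ 0 → InD S (∑ i, c i * x i ^ 2))
    (han : ∀ x : ι → F, ∑ i, c i * x i ^ 2 = 0 → x = 0) :
    ∀ (n : ℕ) (p : F[X]), p.natDegree = n → p.Monic → p.eval 0 ≠ 0 →
      ∀ w : ι → F[X], p ∣ (∑ i, C (c i) * w i ^ 2) - X → InD S ((-1) ^ n * p.eval 0) := by
  intro n
  induction n using Nat.strong_induction_on with
  | _ n ih =>
  intro p hpn hp hp0 w hw
  rcases Nat.lt_or_ge n 2 with hn | hn
  · interval_cases n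
    · rw [hp.natDegree_eq_zero.mp hpn]
      simpa using InD.one S
    · have hpe := hp.eq_X_add_C hpn
      obtain ⟨h, hh⟩ := hw
      have h1 := congrArg (eval (-p.coeff 0)) hh
      have h2 : eval (-p.coeff 0) p = 0 := by rw [hpe]; simp
      have h3 : (-1) ^ 1 * p.eval 0 = - p.coeff 0 := by rw [coeff_zero_eq_eval_zero]; ring
      rw [eval_mul, h2, zero_mul, eval_sub, eval_X, eval_finsetSum, sub_eq_zero] at h1
      simp only [eval_mul, eval_C, eval_pow] at h1
      rw [h3, ← h1]
      apply hS
      rw [h1, ← coeff_zero_eq_eval_zero] at *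
      simpa using hp0
  -- reduce `w` modulo `p`
  have hp1 : p ≠ 1 := by rintro rfl; simp at hpn; omega
  set v : ι → F[X] := fun i => w i %ₘ p with hv
  have hvdeg : ∀ i, (v i).natDegree < n := by
    intro i; rw [← hpn]; exact natDegree_modByMonic_lt _ hp hp1
  have hvp : p ∣ (∑ i, C (c i) * v i ^ 2) - X := by
    have : (∑ i, C (c i) * v i ^ 2) - X = ((∑ i, C (c i) * w i ^ 2) - X) -
        ∑ i, C (c i) * (w i ^ 2 - v i ^ 2) := by
      simp only [mul_sub, Finset.sum_sub_distrib]; ring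
    rw [this]
    refine dvd_sub hw (Finset.dvd_sum fun i _ => Dvd.dvd.mul_left ?_ _)
    rw [sq_sub_sq]
    refine Dvd.dvd.mul_left ⟨w i /ₘ p, ?_⟩ _
    have := modByMonic_add_div (w i) p
    simp only [hv]
    linear_combination this.symm
  clear_value v
  set d := Finset.univ.sup fun i => (v i).natDegree with hd
  have hvd : ∀ i, (v i).natDegree ≤ d := fun i =>
    Finset.le_sup (f := fun i => (v i).natDegree) (Finset.mem_univ i)
  have hdn : d < n := by
    rw [hd, Finset.sup_lt_iff (by simp; omega)]
    exact fun i _ => hvdeg i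
  set Q := ∑ i, C (c i) * v i ^ 2 with hQ
  have hQdeg : Q.natDegree ≤ 2 * d := by
    refine natDegree_sum_le_of_forall_le _ _ fun i _ => ?_
    refine (natDegree_C_mul_le _ _).trans (natDegree_pow_le.trans ?_)
    have := hvd i
    omega
  have hQc : Q.coeff (2 * d) = ∑ i, c i * ((v i).coeff d) ^ 2 := by
    rw [hQ, finsetSum_coeff]
    refine Finset.sum_congr rfl fun i _ => ?_
    rw [coeff_C_mul, coeff_pow_of_natDegree_le (hvd i)]
  have hQ0 : Q.eval 0 = ∑ i, c i * ((v i).eval 0) ^ 2 := by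
    simp [hQ, eval_finsetSum]
  obtain ⟨h, hh⟩ := hvp
  have hd0 : d ≠ 0 := by
    intro h0
    have h1 : (Q - X).natDegree ≤ 1 := by
      refine (natDegree_sub_le _ _).trans ?_
      simp; omega
    have h2 : (Q - X) ≠ 0 := by
      intro h3
      have h4 := congrArg (fun r => coeff r 1) h3
      simp only [coeff_sub, coeff_X_one, coeff_zero] at h4
      rw [coeff_eq_zero_of_natDegree_lt (by omega)] at h4
      simp at h4
    have h3 := natDegree_le_of_dvd ⟨h, hh⟩ h2
    omega
  have hlead : Q.coeff (2 * d) ≠ 0 := by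
    intro h0
    rw [hQc] at h0
    have h1 := han _ h0
    obtain ⟨i, -, hi⟩ := Finset.exists_mem_eq_sup (Finset.univ : Finset ι)
      (by by_contra hne; rw [Finset.not_nonempty_iff_eq_empty] at hne; rw [hne] at hd; simp at hd
          exact hd0 hd) (fun i => (v i).natDegree)
    have h2 : (v i).coeff d = 0 := congrFun h1 i
    rw [hd, hi] at h2
    have h3 : v i = 0 := leadingCoeff_eq_zero.mp h2
    rw [← hd] at hi
    rw [h3] at hi
    simp at hi
    exact hd0 hi
  have hcoef : (Q - X).coeff (2 * d) = Q.coeff (2 * d) := by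
    rw [coeff_sub, coeff_X_of_ne_one (by omega), sub_zero]
  have hdeg : (Q - X).natDegree = 2 * d := by
    apply le_antisymm
    · refine (natDegree_sub_le _ _).trans ?_
      simp; omega
    · exact le_natDegree_of_ne_zero (by rw [hcoef]; exact hlead)
  have hQX : Q - X ≠ 0 := by
    intro h0; rw [h0] at hcoef; simp at hcoef; exact hlead hcoef.symm
  have hne : h ≠ 0 := by rintro rfl; simp at hh; exact hQX hh
  have hhd : n + h.natDegree = 2 * d := by
    rw [← hdeg, hh, natDegree_mul hp.ne_zero hne, hpn]
  have hhl : h.leadingCoeff = Q.coeff (2 * d) := by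
    rw [← hcoef, ← hdeg]
    change _ = (Q - X).leadingCoeff
    rw [hh, leadingCoeff_mul, hp.leadingCoeff, one_mul]
  have hlD : InD S h.leadingCoeff := by
    rw [hhl, hQc]; apply hS; rw [← hQc]; exact hlead
  have step : ∀ g : F[X], g.natDegree < n → g.leadingCoeff = h.leadingCoeff → g.eval 0 ≠ 0 →
      g ∣ Q - X → InD S ((-1) ^ g.natDegree * g.eval 0) := by
    intro g hgn hgl hg0 hgd
    have hl0 : h.leadingCoeff ≠ 0 := leadingCoeff_ne_zero.mpr hne
    have h1 := ih g.natDegree hgn (C (h.leadingCoeff⁻¹) * g)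
      (natDegree_C_mul (inv_ne_zero hl0))
      (by rw [Monic, leadingCoeff_mul, leadingCoeff_C, hgl]; exact inv_mul_cancel₀ hl0)
      (by rw [eval_mul, eval_C]; exact mul_ne_zero (inv_ne_zero hl0) hg0) v
      (by
        obtain ⟨k, hk⟩ := hgd
        refine ⟨C h.leadingCoeff * k, ?_⟩
        rw [hk, show C h.leadingCoeff⁻¹ * g * (C h.leadingCoeff * k) =
          (C h.leadingCoeff⁻¹ * C h.leadingCoeff) * (g * k) by ring, ← C_mul,
          inv_mul_cancel₀ hl0]
        simp)
    have h2 := h1.mul hlD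
    convert h2 using 1
    rw [eval_mul, eval_C]
    field_simp
  have hev := congrArg (eval 0) hh
  rw [eval_sub, eval_X, eval_mul, sub_zero] at hev
  by_cases hh0 : h.eval 0 = 0
  · obtain ⟨g, hg⟩ := (dvd_iff_isRoot (p := h) (a := 0)).mpr hh0
    rw [C_0, sub_zero] at hg
    rw [hh0, mul_zero, hQ0] at hev
    have h1 := han _ hev
    have h2 : (X : F[X]) ^ 2 ∣ Q := by
      refine Finset.dvd_sum fun i _ => Dvd.dvd.mul_left (pow_dvd_pow_of_dvd ?_ 2) _
      rw [X_dvd_iff, coeff_zero_eq_eval_zero]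
      exact congrFun h1 i
    obtain ⟨k, hk⟩ := h2
    have h3 : X * k - 1 = p * g := by
      apply mul_left_cancel₀ (X_ne_zero (R := F))
      rw [hk, hg] at hh
      linear_combination hh
    have h4 := congrArg (eval 0) h3
    simp only [eval_sub, eval_mul, eval_X, zero_mul, eval_one, zero_sub] at h4
    have hgne : g ≠ 0 := by rintro rfl; simp at hg; exact hne hg
    have hgdeg : h.natDegree = 1 + g.natDegree := by
      rw [hg, natDegree_mul X_ne_zero hgne, natDegree_X]
    have hgD := step g (by omega) (by rw [hg, leadingCoeff_mul, leadingCoeff_X, one_mul])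
      (by intro h0; rw [h0] at h4; simp at h4) ⟨X * p, by rw [hh, hg]; ring⟩
    refine InD.of_mul (b := (-1) ^ g.natDegree * g.eval 0) ?_ hgD
    convert InD.one S using 1
    have h5 : (-1 : F) ^ n * (-1) ^ g.natDegree = -1 := by
      rw [← pow_add]
      exact Odd.neg_one_pow ⟨d - 1, by omega⟩
    linear_combination (eval 0 p * eval 0 g) * h5 + h4
  · have hhD := step h (by omega) rfl hh0 ⟨p, by rw [hh]; ring⟩
    refine InD.of_mul (b := (-1) ^ h.natDegree * h.eval 0) ?_ hhD
    have h5 : (-1 : F) ^ n * (-1) ^ h.natDegree = 1 := by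
      rw [← pow_add, hhd]
      exact Even.neg_one_pow ⟨d, by omega⟩
    have h6 : (-1) ^ n * eval 0 p * ((-1) ^ h.natDegree * eval 0 h) =
        ∑ i, c i * ((v i).eval 0) ^ 2 := by
      rw [← hQ0, hev]
      linear_combination (eval 0 p * eval 0 h) * h5
    rw [h6]
    apply hS
    rw [← hQ0, hev]
    exact mul_ne_zero hp0 hh0

theorem exists_gen {F E : Type*} [Field F] [Field E] [Algebra F E]
    [Infinite F] [Invertible (2 : F)] [FiniteDimensional F E] [Algebra.IsSeparable F E]
    (x : E) (hx : x ≠ 0) : ∃ y : E, y ≠ 0 ∧ IntermediateField.adjoin F {x * y ^ 2} = ⊤ := by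
  classical
  obtain ⟨θ, hθ⟩ := Field.exists_primitive_element F E
  have hfin : Finite (IntermediateField F E) :=
    (Field.exists_primitive_element_iff_finite_intermediateField F E).mp ⟨inferInstance, θ, hθ⟩
  have h2 : (2 : F) ≠ 0 := Invertible.ne_zero 2
  let f : F → IntermediateField F E := fun c =>
    IntermediateField.adjoin F {x * (θ + algebraMap F E c) ^ 2}
  obtain ⟨K, hK⟩ := Finite.exists_infinite_fiber f
  have hK' : (f ⁻¹' {K}).Infinite := Set.infinite_coe_iff.mp hK
  have hKm : ∀ c ∈ f ⁻¹' {K}, x * (θ + algebraMap F E c) ^ 2 ∈ K := by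
    intro c hc
    have : f c = K := hc
    rw [← this]
    exact IntermediateField.mem_adjoin_simple_self F _
  obtain ⟨a, ha⟩ := hK'.nonempty
  obtain ⟨b, hb, hba⟩ := hK'.exists_notMem_finset {a}
  obtain ⟨c, hc, hcab⟩ := hK'.exists_notMem_finset {a, b}
  obtain ⟨e, he, hen⟩ := hK'.exists_notMem_finset
    (if h : ∃ e : F, θ + algebraMap F E e = 0 then {h.choose} else ∅)
  simp at hba hcab
  have hA := hKm a ha
  have hB := hKm b hb
  have hC := hKm c hc
  have hm : ∀ (r : F), algebraMap F E r ∈ K := fun r => K.algebraMap_mem r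
  set A := algebraMap F E a
  set B := algebraMap F E b
  set CC := algebraMap F E c
  have nAB : B - A ≠ 0 := by
    rw [sub_ne_zero]; exact fun h => hba ((algebraMap F E).injective h)
  have nAC : CC - A ≠ 0 := by
    rw [sub_ne_zero]; exact fun h => hcab.1 ((algebraMap F E).injective h)
  have nBC : CC - B ≠ 0 := by
    rw [sub_ne_zero]; exact fun h => hcab.2 ((algebraMap F E).injective h)
  have n2 : (2 : E) ≠ 0 := by
    have := (map_ne_zero (algebraMap F E)).mpr h2
    rwa [map_ofNat] at this
  -- divided differences
  have d1 : x * (2 * θ + A + B) ∈ K := by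
    have := K.div_mem (K.sub_mem hB hA) (K.sub_mem (hm b) (hm a))
    convert this using 1
    change _ = _ / (B - A)
    field_simp; ring
  have d2 : x * (2 * θ + A + CC) ∈ K := by
    have := K.div_mem (K.sub_mem hC hA) (K.sub_mem (hm c) (hm a))
    convert this using 1
    change _ = _ / (CC - A)
    field_simp; ring
  have hxK : x ∈ K := by
    have := K.div_mem (K.sub_mem d2 d1) (K.sub_mem (hm c) (hm b))
    convert this using 1
    change _ = _ / (CC - B)
    field_simp; ring
  have hθK : θ ∈ K := by
    have h3 : (2 : E) ∈ K := by have := hm 2; rwa [map_ofNat] at this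
    have := K.div_mem (K.sub_mem (K.sub_mem (K.div_mem d1 hxK) (hm a)) (hm b)) h3
    convert this using 1
    change _ = (_ - A - B) / 2
    field_simp; ring
  have hKt : K = ⊤ := by
    rw [eq_top_iff, ← hθ, IntermediateField.adjoin_le_iff]
    simpa using hθK
  refine ⟨θ + algebraMap F E e, ?_, ?_⟩
  · intro h0
    have hex : ∃ e : F, θ + algebraMap F E e = 0 := ⟨e, h0⟩
    rw [dif_pos hex] at hen
    apply hen
    have := hex.choose_spec
    rw [Finset.mem_singleton]
    apply (algebraMap F E).injective
    linear_combination h0 - this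
  · rw [← hKt]; exact he
end

/-- **Knebusch's Norm Principle over fields.** Let `E/F` be a finite
separable extension of infinite fields of characteristic `≠ 2` and `(V, q)` a
nondegenerate quadratic space over `F`.  Then the norm of any element of `E*` represented
by `q_E = q ⊗_F E` lies in the subgroup `D_q(F)` of `F*` generated by the nonzero values
of `q`. -/
theorem knebusch_norm_principle_fields {F E : Type*} [Field F] [Field E] [Algebra F E]
    [Infinite F] [Invertible (2 : F)] [FiniteDimensional F E] [Algebra.IsSeparable F E]
    {V : Type*} [AddCommGroup V] [Module F V] [FiniteDimensional F V]
    (q : QuadraticForm F V) (hq : (QuadraticMap.polarBilin q).Nondegenerate) :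
    ∀ a : Eˣ, (∃ w : E ⊗[F] V, q.baseChange E w = (a : E)) →
      Units.map (Algebra.norm F : E →* F) a ∈
        Subgroup.closure {u : Fˣ | ∃ v : V, q v = (u : F)} := by
  rintro a ⟨w, hw⟩
  set S := Subgroup.closure {u : Fˣ | ∃ v : V, q v = (u : F)} with hSdef
  have hval : ∀ v : V, q v ≠ 0 → InD S (q v) := fun v hv =>
    ⟨Units.mk0 (q v) hv, Subgroup.subset_closure ⟨v, rfl⟩, rfl⟩
  suffices hmain : InD S (Algebra.norm F (a : E)) by
    obtain ⟨u, hu, h⟩ := hmain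
    have : Units.map (Algebra.norm F : E →* F) a = u := Units.ext (by simp [h])
    rwa [this]
  by_cases han : ∀ v : V, q v = 0 → v = 0
  swap
  · push Not at han
    obtain ⟨v, hv0, hv⟩ := han
    have : ∃ u, QuadraticMap.polar q v u ≠ 0 := by
      by_contra! hcon
      exact hv (hq.1 v fun u => by simpa using hcon u)
    obtain ⟨u, hu⟩ := this
    set r := Algebra.norm F (a : E) with hr
    have hr0 : r ≠ 0 := by rw [hr, Algebra.norm_ne_zero_iff]; exact a.ne_zero
    have key2 : q (((r - q u) / QuadraticMap.polar q v u) • v + u) = r := by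
      rw [QuadraticMap.map_add q, QuadraticMap.map_smul, QuadraticMap.polar_smul_left, hv0]
      simp only [smul_eq_mul]
      field_simp
      ring
    rw [← key2]
    apply hval
    rw [key2]
    exact hr0
  -- diagonalise
  let _ : Invertible (2 : E) := by
    have := (inferInstance : Invertible (2 : F)).map (algebraMap F E)
    rwa [map_ofNat] at this
  obtain ⟨b, hb⟩ := LinearMap.BilinForm.exists_orthogonal_basis
    (QuadraticForm.associated_isSymm F q)
  have hqF : ∀ x : Fin (Module.finrank F V) → F, q (∑ i, x i • b i) = ∑ i, q (b i) * x i ^ 2 := by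
    intro x
    have := congrArg (fun Q => Q x) (QuadraticMap.basisRepr_eq_of_iIsOrtho q b hb)
    simpa [QuadraticMap.basisRepr_apply, pow_two] using this
  let bE := Algebra.TensorProduct.basis E b
  have hbE : (QuadraticMap.associated (R := E) (q.baseChange E)).IsOrthoᵢ bE := by
    intro i j hij
    have h0 : QuadraticMap.associated q (b i) (b j) = 0 := hb hij
    change QuadraticMap.associated (R := E) (q.baseChange E) (bE i) (bE j) = 0
    rw [QuadraticForm.associated_baseChange]
    simp only [bE, Algebra.TensorProduct.basis_apply]
    rw [LinearMap.BilinForm.baseChange_tmul, h0]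
    simp
  have hqE : ∀ x : Fin (Module.finrank F V) → E, q.baseChange E (∑ i, x i • bE i) = ∑ i, algebraMap F E (q (b i)) * x i ^ 2 := by
    intro x
    have := congrArg (fun Q => Q x) (QuadraticMap.basisRepr_eq_of_iIsOrtho (q.baseChange E) bE hbE)
    simpa [QuadraticMap.basisRepr_apply, pow_two, bE, Algebra.smul_def] using this
  -- a nonzero value of q
  have hVne : ∃ v : V, q v ≠ 0 := by
    by_contra! hcon
    have h1 := hqE (fun i => bE.repr w i)
    rw [bE.sum_repr, hw] at h1
    simp [hcon] at h1
  obtain ⟨v, hv⟩ := hVne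
  obtain ⟨y, hy, hgen⟩ := exists_gen (F := F) (a : E) a.ne_zero
  have hNy : InD S (Algebra.norm F y ^ 2) := by
    have hn : Algebra.norm F y ≠ 0 := by rwa [Algebra.norm_ne_zero_iff]
    refine InD.of_mul (b := q v) ?_ (hval v hv)
    have : Algebra.norm F y ^ 2 * q v = q (Algebra.norm F y • v) := by
      rw [QuadraticMap.map_smul, smul_eq_mul, pow_two]
    rw [this]
    apply hval
    rw [← this]
    exact mul_ne_zero (pow_ne_zero _ hn) hv
  refine InD.of_mul (b := Algebra.norm F y ^ 2) ?_ hNy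
  rw [← map_pow, ← map_mul]
  set z : E := a * y ^ 2 with hz
  have hz0 : z ≠ 0 := mul_ne_zero a.ne_zero (pow_ne_zero _ hy)
  have hint : IsIntegral F z := Algebra.IsIntegral.isIntegral z
  have hadj : Algebra.adjoin F {z} = ⊤ := IntermediateField.adjoin_eq_top_iff.mp hgen
  let pb := PowerBasis.ofAdjoinEqTop hint hadj
  have hnorm : Algebra.norm F z = (-1) ^ (minpoly F z).natDegree * (minpoly F z).eval 0 := by
    have := Algebra.PowerBasis.norm_gen_eq_coeff_zero_minpoly pb
    rw [Polynomial.coeff_zero_eq_eval_zero] at this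
    exact this
  rw [hnorm]
  have hsurj : ∀ e : E, ∃ f : Polynomial F, Polynomial.aeval z f = e := by
    intro e
    have : e ∈ Algebra.adjoin F {z} := by rw [hadj]; trivial
    rw [Algebra.adjoin_singleton_eq_range_aeval] at this
    exact this
  choose f hf using fun i => hsurj (y * bE.repr w i)
  refine key S (fun i => q (b i)) ?_ ?_ _ (minpoly F z) rfl (minpoly.monic hint) ?_ f ?_
  · intro x hx
    rw [← hqF] at hx ⊢
    exact hval _ hx
  · intro x hx
    rw [← hqF] at hx
    have h1 := han _ hx
    exact funext fun i => Fintype.linearIndependent_iff.mp b.linearIndependent x h1 i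
  · rw [← Polynomial.coeff_zero_eq_eval_zero]
    exact minpoly.coeff_zero_ne_zero hint hz0
  · apply minpoly.dvd
    have h1 := hqE (fun i => bE.repr w i)
    rw [bE.sum_repr, hw] at h1
    simp only [map_sub, map_sum, map_mul, map_pow, Polynomial.aeval_C, Polynomial.aeval_X, hf]
    rw [hz, h1, Finset.sum_mul, sub_eq_zero]
    exact Finset.sum_congr rfl fun i _ => by ring
end

section
/- Let R be a semi-local Noetherian domain with infinite residue fields of characteristic ≠ 2, S a finite étale R-algebra, and (V, q) a quadratic space over R. Then N^S_R(D_q(S)) ⊆ D_q(R): the norm of any product of units of S represented by q_S is a product of units of R represented by q. -/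
open scoped TensorProduct

universe u

namespace NP
open Polynomial

/-- The quadratic form with matrix `M`. -/
noncomputable def QM {A : Type*} [CommRing A] {m : ℕ} (M : Matrix (Fin m) (Fin m) A)
    (v : Fin m → A) : A := ∑ i, ∑ j, M i j * v i * v j

section QM
variable {A B : Type*} [CommRing A] [CommRing B] {m : ℕ} (M : Matrix (Fin m) (Fin m) A)

lemma QM_map (φ : A →+* B) (v : Fin m → A) :
    φ (QM M v) = QM (M.map φ) (fun i => φ (v i)) := by
  simp [QM, map_sum]

lemma QM_smul (s : A) (v : Fin m → A) : QM M (fun i => s * v i) = s ^ 2 * QM M v := by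
  simp only [QM, Finset.mul_sum]
  refine Finset.sum_congr rfl fun i _ => Finset.sum_congr rfl fun j _ => ?_
  ring

/-- The polar form. -/
noncomputable def BM (v w : Fin m → A) : A := ∑ i, ∑ j, M i j * (v i * w j + w i * v j)

lemma QM_add_mul (c : A) (v w : Fin m → A) :
    QM M (fun i => v i + c * w i) = QM M v + c * BM M v w + c ^ 2 * QM M w := by
  simp only [QM, BM, Finset.mul_sum, ← Finset.sum_add_distrib]
  refine Finset.sum_congr rfl fun i _ => Finset.sum_congr rfl fun j _ => ?_
  ring

lemma BM_map (φ : A →+* B) (v w : Fin m → A) :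
    φ (BM M v w) = BM (M.map φ) (fun i => φ (v i)) (fun i => φ (w i)) := by
  simp [BM, map_sum]

lemma BM_smul (s : A) (v w : Fin m → A) : BM M (fun i => s * v i) w = s * BM M v w := by
  simp only [BM, Finset.mul_sum]
  refine Finset.sum_congr rfl fun i _ => Finset.sum_congr rfl fun j _ => ?_
  ring

lemma BM_self (v : Fin m → A) : BM M v v = 2 * QM M v := by
  simp only [BM, QM, Finset.mul_sum]
  refine Finset.sum_congr rfl fun i _ => Finset.sum_congr rfl fun j _ => ?_
  ring

lemma QM_dvd (p : A) (v w : Fin m → A) (h : ∀ i, p ∣ v i - w i) : p ∣ QM M v - QM M w := by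
  simp only [QM, ← Finset.sum_sub_distrib]
  refine Finset.dvd_sum fun i _ => Finset.dvd_sum fun j _ => ?_
  have : M i j * v i * v j - M i j * w i * w j
    = M i j * v j * (v i - w i) + M i j * w i * (v j - w j) := by ring
  rw [this]
  exact dvd_add ((h i).mul_left _) ((h j).mul_left _)

lemma QM_natDegree (d : ℕ) (f : Fin m → A[X]) (hf : ∀ i, (f i).natDegree ≤ d) :
    (QM (M.map C) f).natDegree ≤ d + d := by
  refine natDegree_sum_le_of_forall_le _ _ fun i _ => natDegree_sum_le_of_forall_le _ _ fun j _ => ?_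
  refine natDegree_mul_le_of_le ?_ (hf j)
  simpa using (natDegree_C_mul_le _ _).trans (hf i)

lemma QM_coeff (d : ℕ) (f : Fin m → A[X]) (hf : ∀ i, (f i).natDegree ≤ d) :
    (QM (M.map C) f).coeff (d + d) = QM M (fun i => (f i).coeff d) := by
  simp only [QM, finsetSum_coeff]
  refine Finset.sum_congr rfl fun i _ => Finset.sum_congr rfl fun j _ => ?_
  rw [Matrix.map_apply, mul_assoc, coeff_C_mul, coeff_mul_add_eq_of_natDegree_le (hf i) (hf j), mul_assoc]

lemma QM_poly_map (φ : A →+* B) (f : Fin m → A[X]) :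
    (QM (M.map C) f).map φ = QM ((M.map φ).map C) (fun i => (f i).map φ) := by
  rw [← coe_mapRingHom, QM_map]
  congr 1
  ext i j : 2
  simp

lemma QM_eval (a : A) (f : Fin m → A[X]) :
    (QM (M.map C) f).eval a = QM M (fun i => (f i).eval a) := by
  rw [← coe_evalRingHom, QM_map]
  congr 1
  ext i j : 2
  simp

lemma BM_eval (a : A) (f g : Fin m → A[X]) :
    (BM (M.map C) f g).eval a = BM M (fun i => (f i).eval a) (fun i => (g i).eval a) := by
  rw [← coe_evalRingHom, BM_map]
  congr 1
  ext i j : 2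
  simp

/-- modified vector -/
noncomputable def ff (p : A[X]) (f : Fin m → A[X]) (s : A[X]) : Fin m → A[X] :=
  fun i => (s * f i) %ₘ p

noncomputable def Phi (d : ℕ) (p : A[X]) (f : Fin m → A[X]) (s : A[X]) : A :=
  (QM (M.map C) (ff p f s) %ₘ p).coeff d * QM M (fun i => (ff p f s i).coeff d) *
    resultant (QM (M.map C) (ff p f s) %ₘ p) (QM (M.map C) (ff p f s)) d (d + d)

lemma ff_map (φ : A →+* B) (p : A[X]) (hp : p.Monic) (f : Fin m → A[X]) (s : A[X]) (i : Fin m) :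
    (ff p f s i).map φ = ff (p.map φ) (fun i => (f i).map φ) (s.map φ) i := by
  simp [ff, map_modByMonic φ hp]

lemma Phi_map (φ : A →+* B) (d : ℕ) (p : A[X]) (hp : p.Monic) (f : Fin m → A[X]) (s : A[X]) :
    φ (Phi M d p f s) =
      Phi (M.map φ) d (p.map φ) (fun i => (f i).map φ) (s.map φ) := by
  have h1 : (QM (M.map C) (ff p f s)).map φ =
      QM ((M.map φ).map C) (ff (p.map φ) (fun i => (f i).map φ) (s.map φ)) := by
    rw [QM_poly_map]; congr 1; ext1 i; exact ff_map φ p hp f s i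
  simp only [Phi]
  rw [map_mul, map_mul, ← resultant_map_map, map_modByMonic φ hp, h1, ← coeff_map,
    map_modByMonic φ hp, h1, QM_map]
  simp only [← coeff_map, ff_map φ p hp]

end QM

section rs
variable {A : Type*} [CommRing A]

lemma rs_deg [Nontrivial A] {p : A[X]} (hp : p.Monic) (F : A[X]) (n : ℕ) (hn : F.natDegree ≤ n) :
    resultant p F p.natDegree n = resultant p F := by
  obtain ⟨k, rfl⟩ := Nat.exists_eq_add_of_le hn
  rw [resultant_add_right_deg _ _ _ _ _ le_rfl, coeff_natDegree, hp.leadingCoeff]; simp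

lemma rs_mul [Nontrivial A] {p : A[X]} (hp : p.Monic) (F G : A[X]) :
    resultant p (F * G) = resultant p F * resultant p G := by
  rw [← resultant_mul_right p F G _ le_rfl, rs_deg hp (F * G) _ natDegree_mul_le]

lemma rs_congr [Nontrivial A] {p : A[X]} (hp : p.Monic) {F G : A[X]} (h : p ∣ F - G) :
    resultant p F = resultant p G := by
  obtain ⟨H, hH⟩ := h
  rw [← rs_deg hp F (max F.natDegree (max G.natDegree (H.natDegree + p.natDegree))) (by simp),
    ← rs_deg hp G (max F.natDegree (max G.natDegree (H.natDegree + p.natDegree))) (by simp),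
    show F = G + p * H by rw [← hH]; ring, resultant_add_mul_right _ _ _ _ _ (by simp) le_rfl]

lemma rs_C [Nontrivial A] {p : A[X]} (r : A) :
    resultant p (C r) = r ^ p.natDegree := by
  rw [natDegree_C, resultant_C_zero_right]

lemma rs_mul_left [Nontrivial A] {p p' : A[X]} (hp : p.Monic) (hp' : p'.Monic) (F : A[X]) :
    resultant (p * p') F = resultant p F * resultant p' F := by
  rw [← resultant_mul_left _ _ _ _ le_rfl, hp.natDegree_mul hp']

end rs

section ind
variable {R : Type*} [CommRing R] {m : ℕ} (M : Matrix (Fin m) (Fin m) R)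

/-- subgroup generated by represented units -/
def DD : Subgroup Rˣ := Subgroup.closure {u : Rˣ | ∃ v : Fin m → R, QM M v = (u : R)}

def InD (x : R) : Prop := ∃ u ∈ DD M, (u : R) = x

variable {M}
lemma InD.mul {x y : R} (hx : InD M x) (hy : InD M y) : InD M (x * y) := by
  obtain ⟨u, hu, rfl⟩ := hx
  obtain ⟨w, hw, rfl⟩ := hy
  exact ⟨u * w, mul_mem hu hw, by simp⟩

lemma InD.one : InD M 1 := ⟨1, one_mem _, by simp⟩

lemma InD.pow {x : R} (hx : InD M x) (n : ℕ) : InD M (x ^ n) := by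
  obtain ⟨u, hu, rfl⟩ := hx
  exact ⟨u ^ n, pow_mem hu n, by simp⟩

lemma InD.of_mul {x y : R} (hxy : InD M (x * y)) (hy : InD M y) : InD M x := by
  obtain ⟨u, hu, h⟩ := hxy
  obtain ⟨w, hw, rfl⟩ := hy
  refine ⟨u * w⁻¹, mul_mem hu (inv_mem hw), ?_⟩
  rw [Units.val_mul, h, mul_assoc, Units.mul_inv, mul_one]

lemma InD.of_QM {v : Fin m → R} (h : IsUnit (QM M v)) : InD M (QM M v) :=
  ⟨h.unit, Subgroup.subset_closure ⟨v, rfl⟩, rfl⟩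

lemma InD.sq {v : Fin m → R} (h : IsUnit (QM M v)) {r : R} (hr : IsUnit r) : InD M (r ^ 2) := by
  refine InD.of_mul (y := QM M v) ?_ (InD.of_QM h)
  rw [← QM_smul]
  apply InD.of_QM
  rw [QM_smul]
  exact (hr.pow 2).mul h

theorem main_ind [Nontrivial R] (M : Matrix (Fin m) (Fin m) R)
    (H : ∀ (d : ℕ) (p : R[X]) (f : Fin m → R[X]), 1 ≤ d → p.Monic → p.natDegree = d + 1 →
      IsCoprime p (QM (M.map C) f) → ∃ s, IsUnit (Phi M d p f s)) :
    ∀ (n : ℕ) (p : R[X]) (f : Fin m → R[X]), p.Monic → p.natDegree = n →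
      IsCoprime p (QM (M.map C) f) → InD M (resultant p (QM (M.map C) f)) := by
  intro n
  induction n using Nat.strong_induction_on with
  | _ n ih =>
  intro p f hp hn hc
  have hu := (isUnit_resultant_iff_isCoprime hp).2 hc
  obtain rfl | rfl | ⟨d, hd, rfl⟩ : n = 0 ∨ n = 1 ∨ ∃ d, 1 ≤ d ∧ n = d + 1 := by
    rcases n with _ | _ | n
    · simp
    · simp
    · right; right; exact ⟨n + 1, by simp, rfl⟩
  · obtain rfl := eq_one_of_monic_natDegree_zero hp hn
    simpa using InD.one
  · obtain ⟨a, rfl⟩ : ∃ a, p = X - C a := ⟨-p.coeff 0, by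
      rw [hp.eq_X_add_C hn]; simp⟩
    rw [natDegree_X_sub_C, resultant_X_sub_C_left _ _ _ le_rfl, QM_eval] at hu ⊢
    exact InD.of_QM hu
  obtain ⟨s, hs⟩ := H d p f hd hp hn hc
  set f' := ff p f s with hf'
  rw [Phi, ← hf'] at hs
  set F := QM (M.map C) f' with hF
  set g := F %ₘ p with hg
  set Q := F /ₘ p with hQ
  have hdiv : g + p * Q = F := modByMonic_add_div F p
  obtain ⟨hγ, hres⟩ := IsUnit.mul_iff.1 hs
  obtain ⟨hγ, hη⟩ := IsUnit.mul_iff.1 hγ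
  have hp1 : p ≠ 1 := by rintro rfl; simp at hn
  have hfd : ∀ i, (f' i).natDegree ≤ d := fun i => by
    have := natDegree_modByMonic_lt (s * f i) hp hp1
    rw [hn] at this
    exact Nat.lt_succ_iff.1 this
  have hgd : g.natDegree ≤ d := by
    have := natDegree_modByMonic_lt F hp hp1
    rw [hn] at this
    exact Nat.lt_succ_iff.1 this
  have hFd : F.natDegree ≤ d + d := QM_natDegree M d f' hfd
  have hFc := QM_coeff M d f' hfd
  obtain ⟨γ, hγ⟩ := hγ
  obtain ⟨η, hη'⟩ := hη
  rw [← hη', ← hF] at hFc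
  have hηD : InD M (η : R) := by rw [hη']; exact InD.of_QM (by rw [← hη']; exact η.isUnit)
  have hsq : ∀ r : R, IsUnit r → InD M (r ^ 2) := fun r hr =>
    InD.sq (v := fun i => (f' i).coeff d) (by rw [← hη']; exact η.isUnit) hr
  -- the monic version of g
  set g1 := C ((γ⁻¹ : Rˣ) : R) * g with hg1
  have hgg1 : g = C (γ : R) * g1 := by
    rw [hg1, ← mul_assoc, ← C_mul]; simp
  have hg1m : g1.Monic := by
    refine monic_of_natDegree_le_of_coeff_eq_one d ?_ ?_
    · exact (natDegree_C_mul_le _ _).trans hgd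
    · rw [hg1, coeff_C_mul, ← hγ]; simp
  have hg1d : g1.natDegree = d := by
    refine le_antisymm ((natDegree_C_mul_le _ _).trans hgd) (le_natDegree_of_ne_zero ?_)
    rw [hg1, coeff_C_mul, ← hγ]; simp
  -- the quotient
  have hQd : Q.natDegree ≤ d - 1 := by
    rw [hQ, natDegree_divByMonic _ hp, hn]; omega
  have hQc : Q.coeff (d - 1) = η := by
    rw [← hFc, ← hdiv, coeff_add,
      coeff_eq_zero_of_natDegree_lt (p := g) (by omega), zero_add,
      show d + d = (d + 1) + (d - 1) by omega, coeff_mul_add_eq_of_natDegree_le hn.le hQd,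
      ← hn, coeff_natDegree, hp.leadingCoeff, one_mul]
  set h1 := C ((η⁻¹ : Rˣ) : R) * Q with hh1
  have hQh1 : Q = C (η : R) * h1 := by
    rw [hh1, ← mul_assoc, ← C_mul]; simp
  have hh1m : h1.Monic := by
    refine monic_of_natDegree_le_of_coeff_eq_one (d - 1) ?_ ?_
    · exact (natDegree_C_mul_le _ _).trans hQd
    · rw [hh1, coeff_C_mul, hQc]; simp
  have hh1d : h1.natDegree = d - 1 := by
    refine le_antisymm ((natDegree_C_mul_le _ _).trans hQd) (le_natDegree_of_ne_zero ?_)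
    rw [hh1, coeff_C_mul, hQc]; simp
  -- coprimality
  have hcg : IsCoprime g1 F := by
    rw [← isUnit_resultant_iff_isCoprime hg1m, ← rs_deg hg1m F (d + d) hFd, hg1d]
    rw [hgg1, resultant_C_mul_left] at hres
    exact (IsUnit.mul_iff.1 hres).2
  have hcg' : IsCoprime g F := by
    rw [hgg1]
    exact (isCoprime_mul_unit_left_left (isUnit_C.2 γ.isUnit) _ _).2 hcg
  have hcpQ : IsCoprime g (p * Q) := by
    rw [← hdiv] at hcg'
    exact (IsCoprime.add_mul_left_right_iff (z := 1)).1 (by simpa [add_comm] using hcg')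
  have hch : IsCoprime h1 F := by
    have h2 : IsCoprime Q F := by
      rw [← hdiv]
      exact (IsCoprime.of_mul_right_right hcpQ).symm.add_mul_right_right p
    rw [hQh1] at h2
    exact (isCoprime_mul_unit_left_left (isUnit_C.2 η.isUnit) _ _).1 h2
  have hcp : IsCoprime p F := by
    rw [← hdiv]
    exact (IsCoprime.of_mul_right_left hcpQ).symm.add_mul_left_right Q
  have I1 := ih d (by omega) g1 f' hg1m hg1d hcg
  have I2 := ih (d - 1) (by omega) h1 f' hh1m hh1d hch
  rw [← hF] at I1 I2
  have hcpu := (isUnit_resultant_iff_isCoprime hp).2 hcp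
  have e1 : resultant p F = resultant p (QM (M.map C) f) * resultant p s ^ 2 := by
    rw [mul_comm, pow_two, ← rs_mul hp, ← rs_mul hp, ← pow_two, ← QM_smul]
    refine rs_congr hp (QM_dvd _ _ _ _ fun i => ?_)
    rw [hf', ff, modByMonic_eq_sub_mul_div]
    exact ⟨-((s * f i) /ₘ p), by ring⟩
  have hsu : IsUnit (resultant p s) := by
    rw [e1] at hcpu
    exact (isUnit_pow_iff two_ne_zero).1 (IsUnit.mul_iff.1 hcpu).2
  have e2 : resultant p F = resultant p g := rs_congr hp ⟨Q, by rw [← hdiv]; ring⟩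
  have e3 : resultant h1 F = resultant h1 g :=
    rs_congr hh1m ⟨C (η : R) * p, by rw [← hdiv, hQh1]; ring⟩
  have hph : (p * h1).Monic := hp.mul hh1m
  have hphd : (p * h1).natDegree = d + d := by rw [hp.natDegree_mul hh1m, hn, hh1d]; omega
  have e4 : resultant (p * h1) g = γ ^ (d + d) * resultant g1 (p * h1) := by
    rw [hgg1, rs_mul hph, rs_C, hphd,
      resultant_comm (p * h1) g1]
    rw [Even.neg_one_pow (by rw [← two_mul, mul_assoc]; exact even_two_mul _), one_mul]
  have e5 : resultant g1 F = η ^ d * resultant g1 (p * h1) := by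
    rw [← hg1d, ← rs_C, ← rs_mul hg1m]
    refine rs_congr hg1m ⟨C (γ : R), ?_⟩
    rw [← hdiv, hQh1]
    conv_lhs => rw [hgg1]
    ring
  have e6 : resultant p (QM (M.map C) f) * (resultant p s ^ 2 * resultant h1 F * η ^ d) =
      (γ ^ d) ^ 2 * resultant g1 F := by
    rw [e5, e3, ← mul_assoc, ← mul_assoc, ← e1, e2, ← rs_mul_left hp hh1m, e4]
    ring
  refine InD.of_mul (y := resultant p s ^ 2 * resultant h1 F * η ^ d) ?_
    (((hsq _ hsu).mul I2).mul (hηD.pow d))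
  rw [e6]
  exact (hsq _ (γ.isUnit.pow d)).mul I1

end ind
end NP

namespace NP
open Polynomial
section closed
variable {K : Type*} [Field K] {m : ℕ} (M : Matrix (Fin m) (Fin m) K)

lemma eval_mod {p F : K[X]} {b : K} (hb : p.eval b = 0) :
    (F %ₘ p).eval b = F.eval b := by
  rw [modByMonic_eq_sub_mul_div]; simp [hb]

lemma mod_unique {p F r : K[X]} (hp : p.Monic) (hd : r.degree < p.degree) (h : p ∣ F - r) :
    F %ₘ p = r := by
  obtain ⟨q, hq⟩ := h
  exact (div_modByMonic_unique q r hp ⟨by rw [← hq]; ring, hd⟩).2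

lemma dvd_sub_mod (p F : K[X]) : p ∣ F - F %ₘ p := by
  rw [modByMonic_eq_sub_mul_div]; exact ⟨F /ₘ p, by ring⟩

lemma core [IsAlgClosed K] {d : ℕ} {p p1 : K[X]} {f : Fin m → K[X]} {a : K}
    (hp : p.Monic) (hn : p.natDegree = d + 1) (hp1 : p1.Monic) (hp1d : p1.natDegree = d)
    (hpp : p = (X - C a) * p1) (xa : K) (hxa : xa = QM M (fun i => (f i).eval a)) (hxa0 : xa ≠ 0)
    (s0 T : K[X]) (hs0 : s0.natDegree ≤ d) (hT0 : T ≠ 0)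
    (hκ : 2 * s0.eval a ≠ 0 ∨ p1.eval a ≠ 0)
    (hTp : ∀ β, T.eval β = 0 → p1.eval β ≠ 0)
    (hT : ∀ c β : K,
      ((s0 ^ 2 * QM (M.map C) f) %ₘ p).eval β +
        (2 * s0.eval a * c + p1.eval a * c ^ 2) * xa * p1.eval β = 0 →
      (QM (M.map C) (ff p f s0)).eval β + c * p1.eval β *
        BM M (fun i => (ff p f s0 i).eval β) (fun i => (f i).eval a) +
        c ^ 2 * p1.eval β ^ 2 * xa = 0 → T.eval β = 0) :
    ∃ s : K[X], s.natDegree ≤ d ∧ Phi M d p f s ≠ 0 := by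
  set v : Fin m → K := fun i => (f i).eval a with hv
  set G := (s0 ^ 2 * QM (M.map C) f) %ₘ p with hG
  set f0 := ff p f s0 with hf0
  have hpd : p.degree = (d + 1 : ℕ) := by rw [degree_eq_natDegree hp.ne_zero, hn]
  have hmod : ∀ F : K[X], (F %ₘ p).natDegree ≤ d := fun F => by
    have := natDegree_modByMonic_lt F hp (by rintro rfl; simp at hn)
    omega
  have hlt : ∀ F : K[X], F.natDegree ≤ d → F.degree < p.degree := fun F hF => by
    rw [hpd]
    exact (degree_le_natDegree).trans_lt (by exact_mod_cast Nat.lt_succ_of_le hF)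
  -- p1 * F ≡ F(a) * p1
  have hp1F : ∀ F : K[X], p ∣ p1 * F - C (F.eval a) * p1 := fun F => by
    obtain ⟨q, hq⟩ := X_sub_C_dvd_sub_C_eval (a := a) (p := F)
    refine ⟨q, ?_⟩
    rw [hpp]
    linear_combination p1 * hq
  set κ : K[X] := C (2 * s0.eval a) * X + C (p1.eval a) * X ^ 2 with hκdef
  have hfac : ∀ α δ : K, δ ≠ 0 → C α + κ * C δ ≠ 0 := by
    intro α δ hδ h
    have c1 := congrArg (fun P => coeff P 1) h
    have c2 := congrArg (fun P => coeff P 2) h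
    simp [hκdef, coeff_X, coeff_C, coeff_X_pow, hδ] at c1 c2
    rcases hκ with h | h
    · simp_all
    · simp_all
  set P : K[X] := (C (G.coeff d) + κ * C xa) *
    (C (QM M fun i => (f0 i).coeff d) + C (BM M (fun i => (f0 i).coeff d) v) * X + C xa * X ^ 2) *
    (T.roots.map (fun β => C (G.eval β) + κ * C (xa * p1.eval β))).prod with hP
  have hP0 : P ≠ 0 := by
    refine mul_ne_zero (mul_ne_zero (hfac _ _ hxa0) ?_) ?_
    · intro h
      have c2 := congrArg (fun P => coeff P 2) h
      simp [coeff_X, coeff_C] at c2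
      exact hxa0 c2
    · rw [Ne, Multiset.prod_eq_zero_iff]
      intro h
      obtain ⟨β, hβ, h⟩ := Multiset.mem_map.1 h
      exact hfac _ _ (mul_ne_zero hxa0 (hTp β (isRoot_of_mem_roots hβ))) h
  obtain ⟨c, hc⟩ : ∃ c, P.eval c ≠ 0 := by
    by_contra! hh
    exact hP0 (funext fun r => by simp [hh r])
  rw [hP, eval_mul, eval_mul, mul_ne_zero_iff, mul_ne_zero_iff] at hc
  obtain ⟨⟨hc1, hc2⟩, hc3⟩ := hc
  set k : K := 2 * s0.eval a * c + p1.eval a * c ^ 2 with hk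
  have hκe : κ.eval c = k := by simp [hκdef, hk]
  -- the modified data
  set s := s0 + C c * p1 with hs
  have hff : ff p f s = fun i => f0 i + (C c * p1) * C (v i) := by
    ext1 i
    refine mod_unique hp (hlt _ ?_) ?_
    · refine natDegree_add_le_of_degree_le (hmod _) ?_
      rw [mul_assoc, mul_comm p1, ← mul_assoc, ← C_mul]
      exact (natDegree_C_mul_le _ _).trans hp1d.le
    · have h1 := dvd_sub_mod p (s0 * f i)
      have h2 := (hp1F (f i)).mul_left (C c)
      have := dvd_add h1 h2
      convert this using 1
      simp only [hs, hf0, ff, hv]; ring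
  have hQ : QM (M.map C) (ff p f s) = QM (M.map C) f0 +
      (C c * p1) * BM (M.map C) f0 (fun i => C (v i)) + (C c * p1) ^ 2 * C xa := by
    rw [hff, QM_add_mul, hxa, QM_map M C]
  have hg : QM (M.map C) (ff p f s) %ₘ p = G + C (k * xa) * p1 := by
    refine mod_unique hp (hlt _ ?_) ?_
    · exact natDegree_add_le_of_degree_le (hmod _) ((natDegree_C_mul_le _ _).trans hp1d.le)
    · have h1 : p ∣ QM (M.map C) (ff p f s) - s ^ 2 * QM (M.map C) f := by
        rw [← QM_smul]
        refine QM_dvd _ _ _ _ fun i => ?_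
        rw [dvd_sub_comm]; exact dvd_sub_mod p (s * f i)
      have h2 := dvd_sub_mod p (s0 ^ 2 * QM (M.map C) f)
      have h3 := hp1F ((2 * C c * s0 + C c ^ 2 * p1) * QM (M.map C) f)
      have := dvd_add (dvd_add h1 h2) h3
      convert this using 1
      rw [eval_mul, QM_eval, ← hxa, ← hG]
      simp only [hs, hk, eval_add, eval_mul, eval_pow, eval_C, eval_ofNat, map_add, map_mul, map_pow]
      simp only [map_ofNat]
      ring
  refine ⟨s, ?_, ?_⟩
  · exact natDegree_add_le_of_degree_le hs0 ((natDegree_C_mul_le _ _).trans hp1d.le)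
  have hgc : (G + C (k * xa) * p1).coeff d ≠ 0 := by
    rw [coeff_add, coeff_C_mul, ← hp1d, coeff_natDegree, hp1.leadingCoeff, hp1d]
    simpa [hκe] using hc1
  have hgd : (G + C (k * xa) * p1).natDegree = d := by
    refine le_antisymm ?_ (le_natDegree_of_ne_zero hgc)
    exact natDegree_add_le_of_degree_le (hmod _) ((natDegree_C_mul_le _ _).trans hp1d.le)
  rw [Phi, hg]
  refine mul_ne_zero (mul_ne_zero hgc ?_) ?_
  · have : (fun i => (ff p f s i).coeff d) = fun i => (f0 i).coeff d + c * v i := by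
      ext1 i
      rw [hff]
      simp only [coeff_add, coeff_mul_C, coeff_C_mul]
      rw [← hp1d, coeff_natDegree, hp1.leadingCoeff]; ring
    rw [this, QM_add_mul, ← hxa]
    intro h; apply hc2; rw [← h]; simp; ring
  · have hQd : (QM (M.map C) (ff p f s)).natDegree ≤ d + d := QM_natDegree M d _ fun i => hmod _
    have := resultant_eq_prod_eval (G + C (k * xa) * p1) (QM (M.map C) (ff p f s)) (d + d) hQd
      (IsAlgClosed.splits _)
    rw [hgd] at this
    rw [this]
    refine mul_ne_zero (pow_ne_zero _ ?_) ?_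
    · rw [leadingCoeff, hgd]; exact hgc
    rw [Ne, Multiset.prod_eq_zero_iff]
    intro h
    obtain ⟨β, hβ, h⟩ := Multiset.mem_map.1 h
    have hβ' := isRoot_of_mem_roots hβ
    have e1 : G.eval β + k * xa * p1.eval β = 0 := by simpa [IsRoot] using hβ'
    rw [hQ] at h
    have hTβ := hT c β e1 (by
      rw [← h]
      simp only [eval_add, eval_mul, eval_pow, eval_C, BM_eval]
      ring)
    rw [eval_multiset_prod, Ne, Multiset.prod_eq_zero_iff] at hc3
    apply hc3
    rw [Multiset.map_map, Multiset.mem_map]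
    refine ⟨β, (mem_roots hT0).2 hTβ, ?_⟩
    simp only [Function.comp, eval_add, eval_mul, eval_C, hκe]
    rw [← e1]; ring

theorem closed [IsAlgClosed K] (h2 : (2 : K) ≠ 0) (d : ℕ) (p : K[X]) (f : Fin m → K[X])
    (hd : 1 ≤ d) (hp : p.Monic) (hn : p.natDegree = d + 1)
    (hc : IsCoprime p (QM (M.map C) f)) : ∃ s : K[X], s.natDegree ≤ d ∧ Phi M d p f s ≠ 0 := by
  have hroot : ∀ b, p.eval b = 0 → QM M (fun i => (f i).eval b) ≠ 0 := by
    intro b hb h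
    obtain ⟨u, w, huw⟩ := hc
    have := congrArg (eval b) huw
    simp [hb, QM_eval, h] at this
  obtain ⟨a, ha⟩ := IsAlgClosed.exists_root p (by
    rw [degree_eq_natDegree hp.ne_zero, hn]; exact_mod_cast Nat.succ_ne_zero d)
  obtain ⟨p1, hpp⟩ := dvd_iff_isRoot.2 ha
  have hp1 : p1.Monic := (monic_X_sub_C a).of_mul_monic_left (hpp ▸ hp)
  have hp1d : p1.natDegree = d := by
    have := hn
    rw [hpp, (monic_X_sub_C a).natDegree_mul hp1, natDegree_X_sub_C] at this
    omega
  have hpb : ∀ b, p1.eval b = 0 → p.eval b = 0 := fun b hb => by rw [hpp]; simp [hb]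
  set xa := QM M (fun i => (f i).eval a) with hxa
  have hxa0 : xa ≠ 0 := hroot a ha
  have hf0 : ∀ s0 b, p1.eval b = 0 → ∀ i, (ff p f s0 i).eval b = s0.eval b * (f i).eval b := by
    intro s0 b hb i
    rw [ff, eval_mod (hpb b hb), eval_mul]
  have hTne : ∀ T : K[X], (∀ β, T.eval β = 0 → p1.eval β ≠ 0) → T ≠ 0 := by
    rintro T hT rfl
    obtain ⟨b, hb⟩ := IsAlgClosed.exists_root p1 (by
      rw [degree_eq_natDegree hp1.ne_zero, hp1d]; exact_mod_cast (by omega : d ≠ 0))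
    exact hT b (by simp) hb
  by_cases hπ : p1.eval a = 0
  · -- multiple root
    obtain ⟨μ, hμ⟩ : ∃ μ : K, ∀ b, p1.eval b = 0 → (1 + μ * (b - a)) *
        (4 * xa - 2 * (1 + μ * (b - a)) * BM M (fun i => (f i).eval b) (fun i => (f i).eval a)
          + (1 + μ * (b - a)) ^ 2 * QM M (fun i => (f i).eval b)) ≠ 0 := by
      set E : K → K[X] := fun b => (1 + X * C (b - a)) *
        (C (4 * xa) - 2 * (1 + X * C (b - a)) *
            C (BM M (fun i => (f i).eval b) (fun i => (f i).eval a))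
          + (1 + X * C (b - a)) ^ 2 * C (QM M (fun i => (f i).eval b))) with hE
      have hE0 : ∀ b, E b ≠ 0 := by
        intro b
        by_cases hba : b = a
        · intro h
          have := congrArg (eval 0) h
          simp only [hE, hba, BM_self, ← hxa] at this
          simp at this
          apply hxa0
          linear_combination this
        · have hba' : b - a ≠ 0 := sub_ne_zero.2 hba
          refine mul_ne_zero ?_ ?_
          · intro h
            have := congrArg (eval 0) h
            simp at this
          · intro h
            have := congrArg (eval (-(b - a)⁻¹)) h
            simp [hba', hxa0] at this
            apply h2
            have h4 : (2 : K) * 2 = 0 := by linear_combination this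
            simpa using h4
      have hP0 : (p1.roots.map E).prod ≠ 0 := by
        rw [Ne, Multiset.prod_eq_zero_iff]
        intro h
        obtain ⟨b, -, h⟩ := Multiset.mem_map.1 h
        exact hE0 b h
      obtain ⟨c, hc⟩ : ∃ c, ((p1.roots.map E).prod).eval c ≠ 0 := by
        by_contra! hh
        exact hP0 (funext fun r => by simp [hh r])
      refine ⟨c, fun b hb h => ?_⟩
      rw [eval_multiset_prod, Ne, Multiset.prod_eq_zero_iff] at hc
      apply hc
      rw [Multiset.map_map, Multiset.mem_map]
      refine ⟨b, (mem_roots hp1.ne_zero).2 hb, ?_⟩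
      rw [← h]
      simp [hE]
    set s0 : K[X] := 1 + C μ * (X - C a) with hs0
    have hs0a : s0.eval a = 1 := by simp [hs0]
    set G := (s0 ^ 2 * QM (M.map C) f) %ₘ p with hG
    have hTp : ∀ β, (C (4 * xa) * QM (M.map C) (ff p f s0)
        - 2 * G * BM (M.map C) (ff p f s0) (fun i => C ((f i).eval a)) + G ^ 2).eval β = 0 →
        p1.eval β ≠ 0 := by
      intro b hb hb1
      have hGb : G.eval b = s0.eval b ^ 2 * QM M (fun i => (f i).eval b) := by
        rw [hG, eval_mod (hpb b hb1), eval_mul, QM_eval, eval_pow]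
      simp only [eval_add, eval_sub, eval_mul, eval_C, QM_eval, BM_eval, eval_pow, hf0 s0 b hb1,
        QM_smul, BM_smul, hGb, eval_ofNat] at hb
      have hs0b : s0.eval b = 1 + μ * (b - a) := by simp [hs0]
      have h3 := hμ b hb1
      rw [← hs0b] at h3
      have h4 := hroot b (hpb b hb1)
      apply mul_ne_zero (mul_ne_zero (left_ne_zero_of_mul h3) h4) h3
      linear_combination hb
    refine core M hp hn hp1 hp1d hpp xa hxa hxa0 s0 _ ?_ (hTne _ hTp) (Or.inl ?_) hTp ?_
    · refine natDegree_add_le_of_degree_le (by simp) ((natDegree_C_mul_le _ _).trans ?_)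
      rw [natDegree_X_sub_C]; exact hd
    · rw [hs0a]; simpa using h2
    · intro c β e1 e2
      rw [hs0a, hπ] at e1
      simp only [eval_add, eval_sub, eval_mul, eval_C, BM_eval, eval_pow, eval_ofNat]
      rw [← hG] at e1
      linear_combination (4 * xa) * e2 + (G.eval β - 2 * c * xa * p1.eval β
        - 2 * BM M (fun i => (ff p f s0 i).eval β) (fun i => (f i).eval a)) * e1
  · -- simple root
    set s0 : K[X] := X - C a with hs0
    have hs0a : s0.eval a = 0 := by simp [hs0]
    set G := (s0 ^ 2 * QM (M.map C) f) %ₘ p with hG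
    set π := p1.eval a with hπd
    have hTp : ∀ β, (C xa * (C π * QM (M.map C) (ff p f s0) - p1 * G) ^ 2 + G * C π * p1 *
        (BM (M.map C) (ff p f s0) (fun i => C ((f i).eval a))) ^ 2).eval β = 0 →
        p1.eval β ≠ 0 := by
      intro b hb hb1
      have hba : b - a ≠ 0 := by
        rw [sub_ne_zero]; rintro rfl; exact hπ hb1
      simp only [eval_add, eval_sub, eval_mul, eval_C, QM_eval, BM_eval, eval_pow, hf0 s0 b hb1,
        QM_smul, BM_smul, eval_ofNat, hb1] at hb
      have hs0b : s0.eval b = b - a := by simp [hs0]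
      have h4 := hroot b (hpb b hb1)
      rw [hs0b] at hb
      have : xa * (π * ((b - a) ^ 2 * QM M fun i => eval b (f i))) ^ 2 ≠ 0 :=
        mul_ne_zero hxa0 (pow_ne_zero _ (mul_ne_zero hπ (mul_ne_zero (pow_ne_zero _ hba) h4)))
      apply this
      linear_combination hb
    refine core M hp hn hp1 hp1d hpp xa hxa hxa0 s0 _ ?_ (hTne _ hTp) (Or.inr hπ) hTp ?_
    · rw [natDegree_X_sub_C]; exact hd
    · intro c β e1 e2
      rw [hs0a, ← hπd] at e1
      simp only [eval_add, eval_sub, eval_mul, eval_C, BM_eval, eval_pow]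
      rw [← hG] at e1
      have hU : π * (QM (M.map C) (ff p f s0)).eval β - p1.eval β * G.eval β =
          - (c * π * p1.eval β * BM M (fun i => (ff p f s0 i).eval β) (fun i => (f i).eval a)) := by
        linear_combination π * e2 - p1.eval β * e1
      rw [hU]
      linear_combination π * p1.eval β *
        BM M (fun i => (ff p f s0 i).eval β) (fun i => (f i).eval a) ^ 2 * e1

end closed
end NP

namespace NP
open Polynomial

theorem field_case {k : Type*} [Field k] [Infinite k] {m : ℕ} (M : Matrix (Fin m) (Fin m) k)
    (h2 : (2 : k) ≠ 0) (d : ℕ) (p : k[X]) (f : Fin m → k[X])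
    (hd : 1 ≤ d) (hp : p.Monic) (hn : p.natDegree = d + 1)
    (hc : IsCoprime p (QM (M.map C) f)) : ∃ s : k[X], Phi M d p f s ≠ 0 := by
  let K := AlgebraicClosure k
  let φ : k →+* K := algebraMap k K
  obtain ⟨s, hsd, hs⟩ := closed (M.map φ) (by
      have : φ 2 ≠ 0 := (map_ne_zero φ).2 h2
      rw [map_ofNat] at this
      exact this) d (p.map φ) (fun i => (f i).map φ) hd (hp.map φ)
    (by rw [hp.natDegree_map, hn]) (by
      rw [← QM_poly_map]
      exact hc.map (mapRingHom φ))
  let ι : k →+* MvPolynomial ℕ k := MvPolynomial.C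
  let sA : (MvPolynomial ℕ k)[X] :=
    ∑ i ∈ Finset.range (d + 1), C (MvPolynomial.X i : MvPolynomial ℕ k) * X ^ i
  let Ψ : MvPolynomial ℕ k := Phi (M.map ι) d (p.map ι) (fun i => (f i).map ι) sA
  let ev : MvPolynomial ℕ k →+* K := MvPolynomial.eval₂Hom φ (fun i => s.coeff i)
  have hev : ev.comp ι = φ := RingHom.ext fun x => MvPolynomial.eval₂Hom_C _ _ _
  have h1 : ev Ψ = Phi (M.map φ) d (p.map φ) (fun i => (f i).map φ) s := by
    rw [Phi_map _ _ _ _ (hp.map ι)]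
    congr 1
    · ext i j; rw [← hev]; simp
    · rw [Polynomial.map_map, hev]
    · ext1 i; rw [Polynomial.map_map, hev]
    · rw [s.as_sum_range' (d + 1) (Nat.lt_succ_of_le hsd)]
      simp only [sA, Polynomial.map_sum, Polynomial.map_mul, Polynomial.map_pow, map_C, map_X,
        ← C_mul_X_pow_eq_monomial]
      refine Finset.sum_congr rfl fun i _ => ?_
      rw [show ev (MvPolynomial.X i) = s.coeff i from MvPolynomial.eval₂Hom_X' _ _ _]
  have hΨ : Ψ ≠ 0 := by
    intro h; rw [h, map_zero] at h1; exact hs h1.symm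
  obtain ⟨x, hx⟩ : ∃ x : ℕ → k, MvPolynomial.eval x Ψ ≠ 0 := by
    by_contra! hh
    exact hΨ (MvPolynomial.funext fun x => by simp [hh x])
  have hev' : (MvPolynomial.eval x).comp ι = RingHom.id k := by ext; simp [ι]
  refine ⟨sA.map (MvPolynomial.eval x), ?_⟩
  rw [Phi_map _ _ _ _ (hp.map ι)] at hx
  convert hx using 2
  · ext i j
    simpa using congrArg (fun g : k →+* k => g (M i j)) hev'.symm
  · rw [Polynomial.map_map, hev', Polynomial.map_id]
  · ext1 i
    rw [Polynomial.map_map, hev', Polynomial.map_id]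

theorem field_case' {k : Type*} [CommRing k] (hk : IsField k) [Infinite k] {m : ℕ}
    (M : Matrix (Fin m) (Fin m) k)
    (h2 : (2 : k) ≠ 0) (d : ℕ) (p : k[X]) (f : Fin m → k[X])
    (hd : 1 ≤ d) (hp : p.Monic) (hn : p.natDegree = d + 1)
    (hc : IsCoprime p (QM (M.map C) f)) : ∃ s : k[X], Phi M d p f s ≠ 0 :=
  letI := hk.toField
  field_case M h2 d p f hd hp hn hc

theorem field_case_map {R k : Type*} [CommRing R] [Invertible (2 : R)] [CommRing k]
    (hk : IsField k) [Infinite k] (φ : R →+* k) {m : ℕ}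
    (M : Matrix (Fin m) (Fin m) R) (d : ℕ) (p : R[X]) (f : Fin m → R[X])
    (hd : 1 ≤ d) (hp : p.Monic) (hn : p.natDegree = d + 1)
    (hc : IsCoprime p (QM (M.map C) f)) :
    ∃ s : k[X], Phi (M.map φ) d (p.map φ) (fun i => (f i).map φ) s ≠ 0 := by
  have h2 : (2 : k) ≠ 0 := by
    have hu := (isUnit_of_invertible (2 : R)).map φ
    rw [map_ofNat] at hu
    have := hk.nontrivial
    exact hu.ne_zero
  have hc' : IsCoprime (p.map φ) (QM ((M.map φ).map C) (fun i => (f i).map φ)) := by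
    rw [← QM_poly_map]
    exact hc.map (mapRingHom φ)
  have := hk.nontrivial
  exact field_case' hk _ h2 d _ _ hd (hp.map _) (by rw [hp.natDegree_map, hn]) hc'

theorem semilocal_case {R : Type*} [CommRing R] [Invertible (2 : R)]
    (hsemilocal : {I : Ideal R | I.IsMaximal}.Finite)
    (hres : ∀ I : Ideal R, I.IsMaximal → Infinite (R ⧸ I))
    {m : ℕ} (M : Matrix (Fin m) (Fin m) R)
    (d : ℕ) (p : R[X]) (f : Fin m → R[X])
    (hd : 1 ≤ d) (hp : p.Monic) (hn : p.natDegree = d + 1)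
    (hc : IsCoprime p (QM (M.map C) f)) : ∃ s : R[X], IsUnit (Phi M d p f s) := by
  have hfin : Finite (MaximalSpectrum R) := by
    have := hsemilocal.to_subtype
    exact Finite.of_injective (fun I : MaximalSpectrum R =>
      (⟨I.asIdeal, I.isMaximal⟩ : {I : Ideal R | I.IsMaximal})) fun I J h => by
        ext1; simpa using h
  have key : ∀ I : MaximalSpectrum R, ∃ s : (R ⧸ I.asIdeal)[X],
      Phi (M.map (Ideal.Quotient.mk I.asIdeal)) d (p.map (Ideal.Quotient.mk I.asIdeal))
        (fun i => (f i).map (Ideal.Quotient.mk I.asIdeal)) s ≠ 0 := by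
    intro I
    have := hres I.asIdeal I.isMaximal
    have hm := I.isMaximal
    exact field_case_map ((Ideal.Quotient.maximal_ideal_iff_isField_quotient _).1 hm)
      (Ideal.Quotient.mk I.asIdeal) M d p f hd hp hn hc
  choose s hs using key
  -- lift the coefficients
  have hpw : Pairwise fun I J : MaximalSpectrum R => IsCoprime I.asIdeal J.asIdeal :=
    fun I J h => Ideal.isCoprime_of_isMaximal (fun hh => h (MaximalSpectrum.ext hh))
  have hsurj := Ideal.pi_quotient_surjective (I := fun I : MaximalSpectrum R => I.asIdeal) hpw
  choose r hr using fun n : ℕ => hsurj (fun I => (s I).coeff n)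
  obtain ⟨N, hN⟩ : ∃ N, ∀ I, (s I).natDegree < N := by
    obtain ⟨N, hN⟩ := (Set.finite_range fun I => (s I).natDegree).bddAbove
    exact ⟨N + 1, fun I => Nat.lt_succ_of_le (hN ⟨I, rfl⟩)⟩
  refine ⟨∑ i ∈ Finset.range N, C (r i) * X ^ i, ?_⟩
  by_contra hu
  obtain ⟨I, hI, hmem⟩ := exists_max_ideal_of_mem_nonunits hu
  have e := hs ⟨I, hI⟩
  apply e
  rw [← Ideal.Quotient.eq_zero_iff_mem, Phi_map _ _ _ _ hp] at hmem
  convert hmem using 2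
  rw [(s ⟨I, hI⟩).as_sum_range' N (hN _)]
  simp only [Polynomial.map_sum, Polynomial.map_mul, Polynomial.map_pow, map_C, map_X,
    ← C_mul_X_pow_eq_monomial]
  refine Finset.sum_congr rfl fun i _ => ?_
  rw [← hr i ⟨I, hI⟩]
end NP

namespace NP
open Polynomial

theorem det_aeval_closed {K : Type*} [Field K] [IsAlgClosed K] {n : Type*} [Fintype n]
    [DecidableEq n] (N : Matrix n n K) (F : K[X]) :
    (aeval N F).det = resultant N.charpoly F := by
  have hm := N.charpoly_monic
  rw [(IsAlgClosed.splits F).eq_prod_roots]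
  rw [rs_mul hm, map_mul, Matrix.det_mul, rs_C]
  congr 1
  · rw [Matrix.charpoly_natDegree_eq_dim]
    simp [Matrix.algebraMap_eq_diagonal]
  · induction F.roots using Multiset.induction_on with
    | empty => simp
    | cons a s ih =>
      rw [Multiset.map_cons, Multiset.prod_cons, rs_mul hm, map_mul, Matrix.det_mul, ih]
      congr 1
      rw [natDegree_X_sub_C, resultant_X_sub_C_right _ _ _ le_rfl, Matrix.eval_charpoly,
        Matrix.charpoly_natDegree_eq_dim, ← Matrix.det_neg]
      simp [Matrix.algebraMap_eq_diagonal, Matrix.scalar_apply]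
      rfl

theorem det_aeval {R : Type*} [CommRing R] [IsDomain R] {n : Type*} [Fintype n]
    [DecidableEq n] (N : Matrix n n R) (F : R[X]) :
    (aeval N F).det = resultant N.charpoly F := by
  let K := AlgebraicClosure (FractionRing R)
  let φ : R →+* K := (algebraMap (FractionRing R) K).comp (algebraMap R (FractionRing R))
  have hφ : Function.Injective φ :=
    (algebraMap (FractionRing R) K).injective.comp (IsFractionRing.injective R (FractionRing R))
  apply hφ
  have h := det_aeval_closed (N.map φ) (F.map φ)
  rw [Matrix.charpoly_map, natDegree_map_eq_of_injective hφ, natDegree_map_eq_of_injective hφ,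
    resultant_map_map] at h
  rw [← h, RingHom.map_det]
  congr 1
  rw [← RingHom.mapMatrix_apply φ N, aeval_def, aeval_def, eval₂_map, hom_eval₂]
  congr 1
  ext x i j
  simp [Matrix.algebraMap_eq_diagonal, Matrix.diagonal_apply, apply_ite φ]

theorem field_mono {k A : Type*} [Field k] [Infinite k] [CommRing A] [Algebra k A]
    [Algebra.Etale k A] :
    ∃ y : A, Function.Surjective (aeval y : k[X] →ₐ[k] A) := by
  classical
  let K := AlgebraicClosure k
  let e := Algebra.FormallyEtale.equivPiOfIsSepClosed K (K ⊗[k] A)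
  have hfin : Module.Finite K (PrimeSpectrum (K ⊗[k] A) → K) := by
    have := Algebra.FormallyUnramified.finite_of_free K (K ⊗[k] A)
    exact Module.Finite.equiv e.toLinearEquiv
  have hP : Finite (PrimeSpectrum (K ⊗[k] A)) := by
    have := Algebra.FormallyUnramified.finite_of_free K (K ⊗[k] A)
    have : IsArtinianRing (K ⊗[k] A) := isArtinian_of_tower K inferInstance
    infer_instance
  have := Fintype.ofFinite (PrimeSpectrum (K ⊗[k] A))
  let φ (p : PrimeSpectrum (K ⊗[k] A)) : A →ₗ[k] K :=
    ((Pi.evalAlgHom k (fun _ => K) p).comp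
      ((e.toAlgHom.restrictScalars k).comp Algebra.TensorProduct.includeRight)).toLinearMap
  have hφ (p) (a : A) : φ p a = e (1 ⊗ₜ a) p := rfl
  have hinj : ∀ p p', φ p = φ p' → p = p' := by
    intro p p' h
    by_contra hne
    have h1 : ∀ b : K ⊗[k] A, e b p = e b p' := by
      intro b
      induction b using TensorProduct.induction_on with
      | zero => simp
      | add x y hx hy => simp [hx, hy]
      | tmul c a =>
        have : c ⊗ₜ[k] a = c • ((1 : K) ⊗ₜ[k] a) := by simp [TensorProduct.smul_tmul']
        rw [this, map_smul, Pi.smul_apply, Pi.smul_apply, ← hφ, ← hφ, h]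
    have h2 := h1 (e.symm (Pi.single p 1))
    rw [AlgEquiv.apply_symm_apply, Pi.single_eq_same, Pi.single_eq_of_ne (Ne.symm hne)] at h2
    exact one_ne_zero h2
  obtain ⟨y, hy⟩ : ∃ y : A, Function.Injective fun p => φ p y := by
    by_contra! hh
    let ι := {x : PrimeSpectrum (K ⊗[k] A) × PrimeSpectrum (K ⊗[k] A) // x.1 ≠ x.2}
    obtain ⟨⟨⟨p, p'⟩, hne⟩, hi⟩ := Subspace.exists_eq_top_of_iUnion_eq_univ (k := k) (E := A)
      (p := fun i : ι => LinearMap.ker (φ i.1.1 - φ i.1.2)) (by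
        rw [Set.eq_univ_iff_forall]
        intro y
        have := hh y
        rw [Function.not_injective_iff] at this
        obtain ⟨p, p', h, hne⟩ := this
        rw [Set.mem_iUnion]
        exact ⟨⟨(p, p'), hne⟩, by simpa [sub_eq_zero] using h⟩)
    apply hne
    apply hinj
    rw [LinearMap.ker_eq_top, sub_eq_zero] at hi
    exact hi
  refine ⟨y, ?_⟩
  change Function.Surjective (aeval y : k[X] →ₐ[k] A).toLinearMap
  rw [← Module.FaithfullyFlat.lTensor_surjective_iff_surjective k K]
  intro z
  obtain ⟨F, hF⟩ : ∃ F : K[X], aeval ((1 : K) ⊗ₜ[k] y) F = z := by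
    refine ⟨Lagrange.interpolate Finset.univ (fun p => φ p y) (e z), ?_⟩
    apply e.injective
    ext p
    have h3 := aeval_algHom_apply ((Pi.evalAlgHom K (fun _ => K) p).comp e.toAlgHom)
      ((1 : K) ⊗ₜ[k] y) (Lagrange.interpolate Finset.univ (fun p => φ p y) (e z))
    refine Eq.trans h3.symm ?_
    change aeval (φ p y) _ = _
    rw [coe_aeval_eq_eval]
    exact Lagrange.eval_interpolate_at_node _ hy.injOn (Finset.mem_univ p)
  refine ⟨∑ i ∈ Finset.range (F.natDegree + 1), F.coeff i ⊗ₜ[k] (X ^ i : k[X]), ?_⟩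
  rw [← hF, aeval_eq_sum_range, map_sum]
  refine Finset.sum_congr rfl fun i _ => ?_
  rw [LinearMap.lTensor_tmul]
  simp [TensorProduct.smul_tmul']

theorem semilocal_mono {R S : Type*} [CommRing R] [CommRing S] [Algebra R S] [Module.Finite R S]
    [Algebra.Etale R S]
    (hsemilocal : {I : Ideal R | I.IsMaximal}.Finite)
    (hres : ∀ I : Ideal R, I.IsMaximal → Infinite (R ⧸ I)) :
    ∃ y : S, Function.Surjective (aeval y : R[X] →ₐ[R] S) := by
  have hfin : Finite (MaximalSpectrum R) := by
    have := hsemilocal.to_subtype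
    exact Finite.of_injective (fun I : MaximalSpectrum R =>
      (⟨I.asIdeal, I.isMaximal⟩ : {I : Ideal R | I.IsMaximal})) fun I J h => by
        ext1; simpa using h
  have key : ∀ I : MaximalSpectrum R, ∃ y : (R ⧸ I.asIdeal) ⊗[R] S,
      Function.Surjective (aeval y : (R ⧸ I.asIdeal)[X] →ₐ[R ⧸ I.asIdeal] _) := by
    intro I
    have := hres I.asIdeal I.isMaximal
    have hm := I.isMaximal
    let := Ideal.Quotient.field I.asIdeal
    exact field_mono
  choose y' hy' using key
  have hpw : Pairwise fun I J : MaximalSpectrum R => IsCoprime I.asIdeal J.asIdeal :=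
    fun I J h => Ideal.isCoprime_of_isMaximal (fun hh => h (MaximalSpectrum.ext hh))
  obtain ⟨y, hy⟩ := Ideal.pi_tensorProductMk_quotient_surjective S
    (fun I : MaximalSpectrum R => I.asIdeal) hpw y'
  have hy1 : ∀ I : MaximalSpectrum R, (1 : R ⧸ I.asIdeal) ⊗ₜ[R] y = y' I :=
    fun I => congrFun hy I
  refine ⟨y, ?_⟩
  let L := (aeval y : R[X] →ₐ[R] S).toLinearMap
  have hI : ∀ I : MaximalSpectrum R, ∀ s : S, ∃ G : R[X],
      s - L G ∈ I.asIdeal • (⊤ : Submodule R S) := by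
    intro I s
    obtain ⟨G, hG⟩ := hy' I (1 ⊗ₜ s)
    obtain ⟨G', rfl⟩ := Polynomial.map_surjective (Ideal.Quotient.mk I.asIdeal)
      Ideal.Quotient.mk_surjective G
    refine ⟨G', ?_⟩
    have h1 : aeval (y' I) (G'.map (Ideal.Quotient.mk I.asIdeal))
        = (1 : R ⧸ I.asIdeal) ⊗ₜ[R] (L G') := by
      have h2 := aeval_algHom_apply
        (Algebra.TensorProduct.includeRight : S →ₐ[R] (R ⧸ I.asIdeal) ⊗[R] S) y G'
      change _ = (1 : R ⧸ I.asIdeal) ⊗ₜ[R] (aeval y G') at h2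
      change _ = (1 : R ⧸ I.asIdeal) ⊗ₜ[R] (aeval y G')
      rw [← h2, Algebra.TensorProduct.includeRight_apply, hy1]
      exact aeval_map_algebraMap (R ⧸ I.asIdeal) (y' I) G'
    have h3 : (1 : R ⧸ I.asIdeal) ⊗ₜ[R] (s - L G') = 0 := by
      rw [TensorProduct.tmul_sub, ← h1, hG, sub_self]
    have h4 := congrArg (TensorProduct.quotTensorEquivQuotSMul S I.asIdeal) h3
    rw [map_zero] at h4
    rw [← Submodule.Quotient.mk_eq_zero]
    refine Eq.trans ?_ h4
    exact (TensorProduct.quotTensorEquivQuotSMul_mk_one_tmul I.asIdeal (s - L G')).symm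
  let Q := S ⧸ LinearMap.range L
  have hQ : Module.annihilator R Q = ⊤ := by
    by_contra hne
    obtain ⟨I, hImax, hle⟩ := Ideal.exists_le_maximal _ hne
    obtain ⟨r, hr, hr0⟩ := Submodule.exists_sub_one_mem_and_smul_eq_zero_of_fg_of_le_smul I
      (⊤ : Submodule R Q) Module.Finite.fg_top (by
        rintro x -
        obtain ⟨s, rfl⟩ := Submodule.mkQ_surjective _ x
        obtain ⟨G, hG⟩ := hI ⟨I, hImax⟩ s
        have h5 : (LinearMap.range L).mkQ s = (LinearMap.range L).mkQ (s - L G) := by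
          rw [map_sub, eq_comm, sub_eq_self]
          simp
        rw [h5]
        have := Submodule.mem_map_of_mem (f := (LinearMap.range L).mkQ) hG
        rw [Submodule.map_smul''] at this
        exact Submodule.smul_mono le_rfl le_top this)
    have hrI : r ∈ I := hle (Module.mem_annihilator.2 fun x => hr0 x trivial)
    apply hImax.ne_top
    rw [Ideal.eq_top_iff_one]
    have := I.sub_mem hrI hr
    simpa using this
  intro s
  have h1 : (1 : R) ∈ Module.annihilator R Q := by rw [hQ]; trivial
  have h2 := Module.mem_annihilator.1 h1 ((LinearMap.range L).mkQ s)
  rw [one_smul, Submodule.mkQ_apply, Submodule.Quotient.mk_eq_zero] at h2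
  obtain ⟨G, hG⟩ := h2
  exact ⟨G, hG⟩

end NP

namespace NP
open Polynomial

theorem exists_coords {R S : Type*} [CommRing R] [CommRing S] [Algebra R S] {m : ℕ}
    (w : S ⊗[R] (Fin m → R)) :
    ∃ c : Fin m → S, w = ∑ i, c i ⊗ₜ[R] (Pi.single i 1 : Fin m → R) := by
  induction w using TensorProduct.induction_on with
  | zero => exact ⟨0, by simp⟩
  | add x y hx hy =>
    obtain ⟨c, rfl⟩ := hx
    obtain ⟨d, rfl⟩ := hy
    exact ⟨c + d, by simp [TensorProduct.add_tmul, Finset.sum_add_distrib]⟩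
  | tmul s v =>
    refine ⟨fun i => v i • s, ?_⟩
    simp only [TensorProduct.smul_tmul]
    rw [← TensorProduct.tmul_sum]
    congr 1
    exact pi_eq_sum_univ' v

noncomputable def Gram {R : Type*} [CommRing R] [Invertible (2 : R)] {m : ℕ}
    (q : QuadraticForm R (Fin m → R)) : Matrix (Fin m) (Fin m) R :=
  fun i j => QuadraticMap.associated (R := R) q (Pi.single i 1) (Pi.single j 1)

theorem q_eq {R : Type*} [CommRing R] [Invertible (2 : R)] {m : ℕ}
    (q : QuadraticForm R (Fin m → R)) (v : Fin m → R) : q v = QM (Gram q) v := by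
  rw [← QuadraticMap.associated_eq_self_apply R q v]
  conv_lhs => rw [pi_eq_sum_univ' v]
  simp only [map_sum, LinearMap.sum_apply, map_smul, LinearMap.smul_apply, QM, Gram, smul_eq_mul, Finset.mul_sum]
  rw [Finset.sum_comm]
  refine Finset.sum_congr rfl fun i _ => Finset.sum_congr rfl fun j _ => ?_
  ring

theorem qS_eq {R S : Type*} [CommRing R] [CommRing S] [Algebra R S] [Invertible (2 : R)] {m : ℕ}
    (q : QuadraticForm R (Fin m → R)) (c : Fin m → S) :
    q.baseChange S (∑ i, c i ⊗ₜ[R] (Pi.single i 1 : Fin m → R))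
      = QM ((Gram q).map (algebraMap R S)) c := by
  let : Invertible (2 : S) := ⟨algebraMap R S ⅟2, by
    rw [← map_ofNat (algebraMap R S), ← map_mul, invOf_mul_self, map_one], by
    rw [← map_ofNat (algebraMap R S), ← map_mul, mul_invOf_self, map_one]⟩
  rw [← QuadraticMap.associated_eq_self_apply S (q.baseChange S),
    QuadraticForm.associated_baseChange]
  simp only [map_sum, LinearMap.sum_apply, QM, LinearMap.BilinForm.baseChange_tmul]
  rw [Finset.sum_comm]
  refine Finset.sum_congr rfl fun i _ => Finset.sum_congr rfl fun j _ => ?_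
  rw [Algebra.smul_def, mul_assoc]
  rfl

theorem main {R S : Type*} [CommRing R] [IsDomain R]
    [Invertible (2 : R)]
    (hsemilocal : {I : Ideal R | I.IsMaximal}.Finite)
    (hres : ∀ I : Ideal R, I.IsMaximal → Infinite (R ⧸ I))
    [CommRing S] [Algebra R S] [Algebra.Etale R S] [Module.Finite R S]
    {m : ℕ} (q : QuadraticForm R (Fin m → R)) :
    Subgroup.map (Units.map (Algebra.norm R : S →* R))
        (Subgroup.closure {u : Sˣ | ∃ w : S ⊗[R] (Fin m → R), q.baseChange S w = (u : S)})
      ≤ Subgroup.closure {u : Rˣ | ∃ v : Fin m → R, q v = (u : R)} := by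
  classical
  rw [Subgroup.map_le_iff_le_comap, Subgroup.closure_le]
  rintro u ⟨w, hw⟩
  rw [SetLike.mem_coe, Subgroup.mem_comap]
  simp only [q_eq]
  change _ ∈ DD (Gram q)
  suffices h : InD (Gram q) (Algebra.norm R (u : S)) by
    obtain ⟨x, hx, hxu⟩ := h
    have : x = Units.map (Algebra.norm R : S →* R) u := Units.ext hxu
    rwa [← this]
  by_cases hb : ∃ s : Finset S, Nonempty (Module.Basis s R S)
  swap
  · rw [Algebra.norm_eq_one_of_not_exists_basis R hb]
    exact InD.one
  obtain ⟨s, ⟨b⟩⟩ := hb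
  obtain ⟨y, hy⟩ := semilocal_mono (R := R) (S := S) hsemilocal hres
  obtain ⟨c, rfl⟩ := exists_coords w
  choose f hf using fun i => hy (c i)
  rw [qS_eq] at hw
  have hu : aeval y (QM ((Gram q).map C) f) = (u : S) := by
    rw [← hw]
    have := QM_map ((Gram q).map C) (aeval y : R[X] →ₐ[R] S).toRingHom f
    refine Eq.trans this ?_
    congr 1
    · ext i j
      simp
    · ext1 i
      exact hf i
  let N := Algebra.leftMulMatrix b y
  have hN : Algebra.norm R (u : S) = resultant N.charpoly (QM ((Gram q).map C) f) := by
    rw [← det_aeval, Algebra.norm_eq_matrix_det b, ← hu, aeval_algHom_apply]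
  have hunit : IsUnit (Algebra.norm R (u : S)) := u.isUnit.map (Algebra.norm R)
  rw [hN] at hunit ⊢
  exact main_ind (Gram q) (fun d p f hd hp hn hc =>
      semilocal_case hsemilocal hres (Gram q) d p f hd hp hn hc) _ _ f N.charpoly_monic rfl
    ((isUnit_resultant_iff_isCoprime N.charpoly_monic).1 hunit)
end NP

/-- **the Norm Principle.** Let `R` be a semi-local Noetherian domain with
infinite residue fields of characteristic `≠ 2` (so `2 ∈ Rˣ`), `S` a finite étale
`R`-algebra, and `q` a quadratic space over `R`.  Then `N^S_R(D_q(S)) ⊆ D_q(R)`: the image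
under the norm of the subgroup of `Sˣ` generated by units represented by `q_S` lies in the
subgroup of `Rˣ` generated by units represented by `q`. -/
theorem norm_principle {R S : Type u} [CommRing R] [IsDomain R] [IsNoetherianRing R]
    [Invertible (2 : R)]
    (hsemilocal : {I : Ideal R | I.IsMaximal}.Finite)
    (hres : ∀ I : Ideal R, I.IsMaximal → Infinite (R ⧸ I))
    [CommRing S] [Algebra R S] [Algebra.Etale R S] [Module.Finite R S]
    {m : ℕ} (q : QuadraticForm R (Fin m → R)) :
    Subgroup.map (Units.map (Algebra.norm R : S →* R))
        (Subgroup.closure {u : Sˣ | ∃ w : S ⊗[R] (Fin m → R), q.baseChange S w = (u : S)})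
      ≤ Subgroup.closure {u : Rˣ | ∃ v : Fin m → R, q v = (u : R)} := by
  exact NP.main hsemilocal hres q
end

section
/- Let R be a semi-local Noetherian domain with infinite residue fields of characteristic ≠ 2, S a finite étale R-algebra of degree n, and (V, q) a quadratic space over R. Then N^S_R(D⁰_q(S)) ⊆ D⁰_q(R), where D⁰_q denotes even products of represented units. Moreover, if a ∈ S* is represented by q_S, then N^S_R(a) ∈ D^n_q(R), i.e., N^S_R(a) is a product of an even (resp. odd) number of units represented by q according to whether n is even (resp. odd). -/
open scoped TensorProduct

universe u

namespace NormPr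
open Polynomial

section res
variable {R : Type*} [CommRing R]

lemma res_deg {p g : R[X]} (hp : p.Monic) {e : ℕ} (he : g.natDegree ≤ e) :
    resultant p g p.natDegree e = resultant p g := by
  obtain ⟨k, rfl⟩ := Nat.exists_eq_add_of_le he
  rw [resultant_add_right_deg _ _ _ _ _ le_rfl]
  simp [hp.coeff_natDegree]

lemma res_mul {p : R[X]} (hp : p.Monic) (a b : R[X]) :
    resultant p (a * b) = resultant p a * resultant p b := by
  rw [← resultant_mul_right p a b _ le_rfl, res_deg hp natDegree_mul_le]

lemma res_add_mul {p : R[X]} (hp : p.Monic) (a k : R[X]) :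
    resultant p (a + p * k) = resultant p a := by
  set e := max (max a.natDegree (a + p * k).natDegree) (k.natDegree + p.natDegree)
  rw [← res_deg hp (show (a + p * k).natDegree ≤ e by simp [e]),
    ← res_deg hp (show a.natDegree ≤ e by simp [e]),
    resultant_add_mul_right _ _ _ _ _ (by simp [e]) le_rfl]

lemma res_congr {p : R[X]} (hp : p.Monic) {a b : R[X]} (h : p ∣ a - b) :
    resultant p a = resultant p b := by
  obtain ⟨k, hk⟩ := h
  rw [← res_add_mul hp b k, ← hk]; congr 1; ring_nf
  simp

lemma res_mul_left [Nontrivial R] {p₁ p₂ : R[X]} (h₁ : p₁.Monic) (h₂ : p₂.Monic) (g : R[X]) :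
    resultant (p₁ * p₂) g = resultant p₁ g * resultant p₂ g := by
  rw [← resultant_mul_left _ _ _ _ le_rfl, h₁.natDegree_mul h₂]

lemma res_X_sub_C [Nontrivial R] (b : R) (g : R[X]) :
    resultant (X - C b) g = g.eval b := by
  simp

lemma res_C {p : R[X]} (u : R) : resultant p (C u) = u ^ p.natDegree := by
  simp

lemma res_C_mul {p : R[X]} (hp : p.Monic) (u : R) (g : R[X]) :
    resultant p (C u * g) = u ^ p.natDegree * resultant p g := by
  rw [res_mul hp, res_C]

lemma res_comm (p g : R[X]) :
    resultant p g = (-1) ^ (p.natDegree * g.natDegree) * resultant g p :=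
  resultant_comm _ _ _ _

end res

section Dp
variable {R : Type*} [CommRing R] {m : ℕ}

/-- products of values of `q`, with number of factors of the parity of `i` -/
def Dp (q : QuadraticForm R (Fin m → R)) (i : ℕ) (x : R) : Prop :=
  ∃ L : List (Fin m → R), L.length % 2 = i % 2 ∧ x = (L.map q).prod

variable {q : QuadraticForm R (Fin m → R)}

lemma Dp.one : Dp q 0 1 := ⟨[], by simp⟩

lemma Dp.val (v : Fin m → R) : Dp q 1 (q v) := ⟨[v], by simp⟩

lemma Dp.mul {i j : ℕ} {x y : R} (hx : Dp q i x) (hy : Dp q j y) : Dp q (i + j) (x * y) := by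
  obtain ⟨L, h1, rfl⟩ := hx
  obtain ⟨L', h2, rfl⟩ := hy
  exact ⟨L ++ L', by simp; omega, by simp⟩

lemma Dp.congr {i j : ℕ} {x : R} (hx : Dp q i x) (h : i % 2 = j % 2) : Dp q j x := by
  obtain ⟨L, h1, h2⟩ := hx
  exact ⟨L, h1.trans h, h2⟩

lemma Dp.pow {i : ℕ} {x : R} (hx : Dp q i x) (k : ℕ) : Dp q (k * i) (x ^ k) := by
  induction k with
  | zero => simpa using Dp.one
  | succ k ih => rw [pow_succ, add_mul, one_mul]; exact ih.mul hx

lemma Dp.inv_val {v : Fin m → R} {y : R} (h : q v * y = 1) : Dp q 1 y := by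
  have : y = q (y • v) := by
    rw [QuadraticMap.map_smul, smul_eq_mul]; linear_combination (-y) * h
  rw [this]; exact Dp.val _

lemma Dp.inv {i : ℕ} {x y : R} (hx : Dp q i x) (h : x * y = 1) : Dp q i y := by
  obtain ⟨L, h1, rfl⟩ := hx
  induction L generalizing i y with
  | nil => simp at h h1; subst h; exact Dp.one.congr (by omega)
  | cons v L ih =>
    simp only [List.map_cons, List.prod_cons] at h
    have a := ih (i := i + 1) (y := q v * y) (by simp at h1; omega) (by linear_combination h)
    have b := Dp.inv_val (q := q) (v := v) (y := (L.map q).prod * y) (by linear_combination h)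
    have c := (a.mul b).congr (j := i) (by omega)
    convert c using 1
    linear_combination (-y) * h

lemma Dp.cancel {i j : ℕ} {x y : R} (hxy : Dp q i (x * y)) (hy : Dp q j y) (hu : IsUnit y) :
    Dp q (i + j) x := by
  obtain ⟨z, hz⟩ := hu.exists_right_inv
  have := hxy.mul (hy.inv hz)
  convert this using 1
  linear_combination (-x) * hz

lemma Dp.sq {v : Fin m → R} (hv : IsUnit (q v)) (u : R) : Dp q 0 (u ^ 2) := by
  obtain ⟨z, hz⟩ := hv.exists_right_inv
  have := ((Dp.val (q := q) (u • v)).mul (Dp.inv_val hz)).congr (j := 0) (by norm_num)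
  convert this using 1
  rw [QuadraticMap.map_smul, smul_eq_mul]
  linear_combination (-u^2) * hz

end Dp

section qq
variable {R : Type*} [CommRing R] {m : ℕ} {B B' : Type*} [CommRing B] [Algebra R B]
  [CommRing B'] [Algebra R B']

/-- evaluation of the quadratic polynomial with matrix `M` -/
def qq (M : Matrix (Fin m) (Fin m) R) (x : Fin m → B) : B :=
  ∑ i, ∑ j, algebraMap R B (M i j) * x i * x j

lemma qq_map (M : Matrix (Fin m) (Fin m) R) (φ : B →ₐ[R] B') (x : Fin m → B) :
    φ (qq M x) = qq M (fun i => φ (x i)) := by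
  simp [qq]

lemma qq_mul (M : Matrix (Fin m) (Fin m) R) (c : B) (x : Fin m → B) :
    qq M (fun i => c * x i) = c ^ 2 * qq M x := by
  simp only [qq, Finset.mul_sum]
  exact Finset.sum_congr rfl fun i _ => Finset.sum_congr rfl fun j _ => by ring

lemma qq_dvd (M : Matrix (Fin m) (Fin m) R) (p : B) (x y : Fin m → B) (h : ∀ i, p ∣ x i - y i) :
    p ∣ qq M x - qq M y := by
  simp only [qq, ← Finset.sum_sub_distrib]
  refine Finset.dvd_sum fun i _ => Finset.dvd_sum fun j _ => ?_
  have : algebraMap R B (M i j) * x i * x j - algebraMap R B (M i j) * y i * y j =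
    algebraMap R B (M i j) * ((x i - y i) * x j + y i * (x j - y j)) := by ring
  rw [this]
  exact Dvd.dvd.mul_left (dvd_add ((h i).mul_right _) ((h j).mul_left _)) _

lemma qq_natDegree (M : Matrix (Fin m) (Fin m) R) (d : ℕ) (x : Fin m → R[X])
    (h : ∀ i, (x i).natDegree ≤ d) : (qq M x).natDegree ≤ 2 * d := by
  refine natDegree_sum_le_of_forall_le _ _ fun i _ => natDegree_sum_le_of_forall_le _ _ fun j _ => ?_
  rw [mul_assoc]
  refine (natDegree_C_mul_le _ _).trans (natDegree_mul_le.trans ?_)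
  have := h i; have := h j; omega

lemma qq_coeff (M : Matrix (Fin m) (Fin m) R) (d : ℕ) (x : Fin m → R[X])
    (h : ∀ i, (x i).natDegree ≤ d) : (qq M x).coeff (2 * d) = qq M (fun i => (x i).coeff d) := by
  simp only [qq, finsetSum_coeff]
  refine Finset.sum_congr rfl fun i _ => Finset.sum_congr rfl fun j _ => ?_
  rw [mul_assoc, mul_assoc]
  erw [coeff_C_mul]
  rw [two_mul, coeff_mul_add_eq_of_natDegree_le (h i) (h j)]
  rfl

end qq

section gen
variable {R : Type*} [CommRing R]

lemma crt (hs : {I : Ideal R | I.IsMaximal}.Finite) (P : Ideal R → R → Prop)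
    (h : ∀ I : Ideal R, I.IsMaximal → ∃ z, P I z) 
    (hP : ∀ I : Ideal R, I.IsMaximal → ∀ z z', z - z' ∈ I → P I z' → P I z) :
    ∃ z, ∀ I : Ideal R, I.IsMaximal → P I z := by
  choose! z hz using h
  have := hs.to_subtype
  obtain ⟨y, hy⟩ := Ideal.exists_forall_sub_mem_ideal
    (I := fun I : {I : Ideal R | I.IsMaximal} => I.1)
    (by
      intro I J hne
      have hI : I.1.IsMaximal := I.2
      have hJ : J.1.IsMaximal := J.2
      exact Ideal.isCoprime_of_isMaximal (fun h => hne (Subtype.ext h))) (fun I => z I.1)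
  exact ⟨y, fun I hI => hP I hI _ _ (hy ⟨I, hI⟩) (hz I hI)⟩

lemma isUnit_of_max {x : R} (h : ∀ I : Ideal R, I.IsMaximal → x ∉ I) : IsUnit x := by
  by_contra hx
  obtain ⟨I, hI, hxI⟩ := exists_max_ideal_of_mem_nonunits hx
  exact h I hI hxI

lemma gen (hs : {I : Ideal R | I.IsMaximal}.Finite)
    (hres : ∀ I : Ideal R, I.IsMaximal → Infinite (R ⧸ I)) (F : R[X])
    (hF : ∀ I : Ideal R, I.IsMaximal → F.map (Ideal.Quotient.mk I) ≠ 0) :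
    ∃ z, IsUnit (F.eval z) := by
  obtain ⟨z, hz⟩ := crt hs (fun I z => F.eval z ∉ I) (by
    intro I hI
    have := hres I hI
    by_contra! hc
    refine hF I hI (Polynomial.funext fun y => ?_)
    obtain ⟨y, rfl⟩ := Ideal.Quotient.mk_surjective y
    rw [eval_map_apply, eval_zero]
    exact Ideal.Quotient.eq_zero_iff_mem.mpr (hc y)) (by
    intro I hI z z' h hz' hc
    apply hz'
    have := I.mem_of_dvd (F.sub_dvd_eval_sub z z') h
    exact (I.sub_mem_iff_right hc).mp this)
  exact ⟨z, isUnit_of_max hz⟩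

end gen

section key
variable {R : Type u} [CommRing R] [IsDomain R] {m : ℕ}

lemma exists_z (hs : {I : Ideal R | I.IsMaximal}.Finite)
    (hres : ∀ I : Ideal R, I.IsMaximal → Infinite (R ⧸ I))
    {p G : R[X]} (hp : p.Monic) (hn : p.natDegree ≠ 0) (hu : IsUnit (resultant p G)) :
    ∃ z, IsUnit (p.eval z) ∧ IsUnit (G.eval z) := by
  obtain ⟨z, hz⟩ := gen hs hres (p * G) (by
    intro I hI
    rw [Polynomial.map_mul]
    refine mul_ne_zero (hp.map _).ne_zero fun h0 => ?_
    have h := resultant_map_map p G p.natDegree G.natDegree (Ideal.Quotient.mk I)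
    rw [h0, resultant_zero_right, zero_pow hn, zero_mul] at h
    have := hu.map (Ideal.Quotient.mk I)
    rw [← h] at this
    exact not_isUnit_zero this)
  rw [eval_mul] at hz
  exact ⟨z, isUnit_of_mul_isUnit_left hz, isUnit_of_mul_isUnit_right hz⟩

lemma exists_beta (hs : {I : Ideal R | I.IsMaximal}.Finite)
    (hres : ∀ I : Ideal R, I.IsMaximal → Infinite (R ⧸ I))
    {p G r h : R[X]} (hp : p.Monic) (hn : p.natDegree ≠ 0) (hG : G = r + p * h)
    (hu : IsUnit (resultant p G)) :
    ∃ b, IsUnit (p.eval b) ∧ IsUnit (r.eval b) ∧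
      IsUnit (resultant (C (r.eval b) * p - C (p.eval b) * r) G p.natDegree G.natDegree) := by
  have hur : IsUnit (resultant p r) := by rwa [hG, res_add_mul hp] at hu
  set Φ : R[X] := resultant (C r * p.map C - C p * r.map C) (G.map C) p.natDegree G.natDegree with hΦ
  -- compatibility with evaluation
  have hev : ∀ {L : Type u} [CommRing L] (φ : R →+* L) (b : L),
      Φ.eval₂ φ b = resultant (C (r.eval₂ φ b) * p.map φ - C (p.eval₂ φ b) * r.map φ) (G.map φ)
        p.natDegree G.natDegree := by
    intro L _ φ b
    have := resultant_map_map (C r * p.map C - C p * r.map C) (G.map C) p.natDegree G.natDegree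
      (eval₂RingHom φ b)
    rw [← hΦ] at this
    have hc : (eval₂RingHom φ b).comp C = φ := by ext; simp
    have e1 : (C r * p.map C - C p * r.map C).map (eval₂RingHom φ b) =
        C (r.eval₂ φ b) * p.map φ - C (p.eval₂ φ b) * r.map φ := by
      simp only [Polynomial.map_sub, Polynomial.map_mul, map_C, Polynomial.map_map, hc,
        coe_eval₂RingHom]
    have e2 : (G.map C).map (eval₂RingHom φ b) = G.map φ := by rw [Polynomial.map_map, hc]
    show eval₂RingHom φ b Φ = _
    rw [← this, e1, e2]
  obtain ⟨b, hb⟩ := gen hs hres (p * r * Φ) (by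
    intro I hI h0
    let _ := Ideal.Quotient.field I
    let K := R ⧸ I
    let L := AlgebraicClosure K
    let φ : R →+* L := (algebraMap K L).comp (Ideal.Quotient.mk I)
    rw [Polynomial.map_mul, Polynomial.map_mul] at h0
    rcases mul_eq_zero.mp h0 with h1 | h1
    · rcases mul_eq_zero.mp h1 with h1 | h1
      · exact (hp.map _).ne_zero h1
      · have h := resultant_map_map p r p.natDegree r.natDegree (Ideal.Quotient.mk I)
        rw [h1, resultant_zero_right, zero_pow hn, zero_mul] at h
        have := hur.map (Ideal.Quotient.mk I)
        rw [← h] at this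
        exact not_isUnit_zero this
    · obtain ⟨b, hb⟩ := IsAlgClosed.exists_root (p.map φ) (by
        rw [hp.degree_map, degree_eq_natDegree hp.ne_zero]; exact_mod_cast hn)
      rw [IsRoot, eval_map] at hb
      have hrb : r.eval₂ φ b ≠ 0 := by
        obtain ⟨x, y, hxy⟩ := (isUnit_resultant_iff_isCoprime hp).mp hur
        intro hr
        have := congrArg (eval₂ φ b) hxy
        simp [eval₂_add, eval₂_mul, hb, hr] at this
      have h2 := hev φ b
      rw [hb, C_0, zero_mul, sub_zero, resultant_C_mul_left, resultant_map_map] at h2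
      have h3 : Φ.eval₂ φ b = 0 := by
        have : Φ.eval₂ φ b = (Φ.map (Ideal.Quotient.mk I)).eval₂ (algebraMap K L) b := by
          rw [eval₂_map]
        rw [this, h1, eval₂_zero]
      rw [h3] at h2
      rcases mul_eq_zero.mp h2.symm with h4 | h4
      · exact pow_ne_zero _ hrb h4
      · have := hu.map φ
        rw [h4] at this
        exact not_isUnit_zero this)
  rw [eval_mul, eval_mul] at hb
  have h1 := isUnit_of_mul_isUnit_left hb
  refine ⟨b, isUnit_of_mul_isUnit_left h1, isUnit_of_mul_isUnit_right h1, ?_⟩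
  have h2 := isUnit_of_mul_isUnit_right hb
  have h3 := hev (RingHom.id R) b
  rw [eval₂_id, eval₂_id, eval₂_id, Polynomial.map_id, Polynomial.map_id, Polynomial.map_id] at h3
  rwa [h3] at h2

lemma exists_w (M : Matrix (Fin m) (Fin m) R) {p : R[X]} (hp : p.Monic) {n : ℕ}
    (hn : p.natDegree = n + 1) (z : R) (hz : IsUnit (p.eval z)) (g : Fin m → R[X])
    (hg : ∀ i, (g i).natDegree ≤ n) :
    ∃ (c : R[X]) (w : Fin m → R[X]), IsUnit (resultant p c) ∧ (∀ i, (w i).natDegree ≤ n) ∧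
      (∀ i, (w i).coeff n = (g i).eval z) ∧ p ∣ qq M w - c ^ 2 * qq M g := by
  set c := p /ₘ (X - C z) with hc
  have hpc : (X - C z) * c = p - C (p.eval z) := by
    have := modByMonic_add_div p (X - C z)
    rw [modByMonic_X_sub_C_eq_C_eval] at this
    rw [← this]; simp [hc]
  have hcd : c.natDegree = n := by
    rw [hc, natDegree_divByMonic _ (monic_X_sub_C z), hn]; simp
  have hcm : c.coeff n = 1 := by
    have := leadingCoeff_divByMonic_X_sub_C p (by
      rw [degree_eq_natDegree hp.ne_zero, hn]; exact_mod_cast (Nat.succ_ne_zero n)) z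
    rw [← hc, hp.leadingCoeff, leadingCoeff, hcd] at this
    exact this
  have hg1 : ∀ i, (g i) = C ((g i).eval z) + (X - C z) * (g i /ₘ (X - C z)) := by
    intro i
    conv_lhs => rw [← modByMonic_add_div (g i) (X - C z), modByMonic_X_sub_C_eq_C_eval]
  have hg1d : ∀ i, (g i /ₘ (X - C z)).natDegree ≤ n := by
    intro i
    rw [natDegree_divByMonic _ (monic_X_sub_C z)]; have := hg i; omega
  have hg1c : ∀ i, (g i /ₘ (X - C z)).coeff n = 0 := by
    intro i
    rcases Nat.eq_zero_or_pos n with h0 | h0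
    · have : (g i /ₘ (X - C z)) = 0 := by
        rw [divByMonic_eq_zero_iff (monic_X_sub_C z), degree_X_sub_C]
        have := hg i
        rw [h0] at this
        exact lt_of_le_of_lt (degree_le_of_natDegree_le this) (by norm_num)
      rw [this, coeff_zero]
    · apply coeff_eq_zero_of_natDegree_lt
      rw [natDegree_divByMonic _ (monic_X_sub_C z), natDegree_X_sub_C]; have := hg i; omega
  refine ⟨c, fun i => C ((g i).eval z) * c - C (p.eval z) * (g i /ₘ (X - C z)), ?_, ?_, ?_, ?_⟩
  · have h1 : resultant p ((X - C z) * c) = resultant p (C (- p.eval z)) := by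
      apply res_congr hp; rw [hpc]; simp
    rw [res_mul hp, res_C] at h1
    exact isUnit_of_mul_isUnit_right (h1 ▸ (hz.neg.pow _))
  · intro i
    refine (natDegree_sub_le _ _).trans (max_le ((natDegree_C_mul_le _ _).trans hcd.le)
      ((natDegree_C_mul_le _ _).trans (hg1d i)))
  · intro i
    simp [hcm, hg1c]
  · rw [← qq_mul]
    refine qq_dvd _ _ _ _ fun i => ⟨- (g i /ₘ (X - C z)), ?_⟩
    have := hg1 i
    set G := g i /ₘ (X - C z)
    calc _ = C ((g i).eval z) * c - C (p.eval z) * G - c * g i := rfl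
      _ = C ((g i).eval z) * c - C (p.eval z) * G - c * (C ((g i).eval z) + (X - C z) * G) := by
        rw [← this]
      _ = _ := by linear_combination (-G) * hpc

lemma cofactor {p p' H Q : R[X]} {k : ℕ} {u ν : R} (hp : p.Monic) (hp'm : p'.Monic) (hHm : H.Monic)
    (hpn : p.natDegree = k + 2) (hp'n : p'.natDegree = k + 2) (hHn : H.natDegree = k)
    (hνu : IsUnit ν) (hid : C ν * Q = p' + p * (C u * H)) :
    resultant p' Q = resultant p Q * (u ^ (k + 2) * ν ^ k * resultant H Q) := by
  have e1 : ν ^ (k + 2) * resultant p' Q =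
      resultant p' p * (u ^ (k + 2) * resultant p' H) := by
    rw [← hp'n, ← res_C_mul hp'm, ← res_C_mul hp'm, ← res_mul hp'm]
    exact res_congr hp'm ⟨1, by rw [hid]; ring⟩
  have e2 : resultant p' p = (-1) ^ ((k + 2) * (k + 2)) * (ν ^ (k + 2) * resultant p Q) := by
    have h2 : resultant p p' = ν ^ (k + 2) * resultant p Q := by
      have h3 : resultant p p' = resultant p (C ν * Q) :=
        res_congr hp ⟨- (C u * H), by rw [hid]; ring⟩
      rw [h3, res_C_mul hp, hpn]
    calc resultant p' p = (-1) ^ (p'.natDegree * p.natDegree) * resultant p p' := res_comm _ _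
      _ = (-1) ^ ((k + 2) * (k + 2)) * resultant p p' := by rw [hp'n, hpn]
      _ = _ := by rw [h2]
  have e3 : resultant p' H = (-1) ^ ((k + 2) * k) * (ν ^ k * resultant H Q) := by
    have h2 : resultant H p' = ν ^ k * resultant H Q := by
      have h3 : resultant H p' = resultant H (C ν * Q) :=
        res_congr hHm ⟨- (p * C u), by rw [hid]; ring⟩
      rw [h3, res_C_mul hHm, hHn]
    calc resultant p' H = (-1) ^ (p'.natDegree * H.natDegree) * resultant H p' := res_comm _ _
      _ = (-1) ^ ((k + 2) * k) * resultant H p' := by rw [hp'n, hHn]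
      _ = _ := by rw [h2]
  have hsign : ((-1 : R) ^ ((k + 2) * (k + 2))) * (-1) ^ ((k + 2) * k) = 1 := by
    rw [← pow_add]; exact Even.neg_one_pow ⟨(k + 2) * (k + 1), by ring⟩
  apply (hνu.pow (k + 2)).mul_left_cancel
  rw [e1, e2, e3]
  linear_combination (ν ^ (k + 2) * resultant p Q * (u ^ (k + 2) * ν ^ k * resultant H Q)) * hsign

set_option maxHeartbeats 1000000 in
theorem key (hs : {I : Ideal R | I.IsMaximal}.Finite)
    (hres : ∀ I : Ideal R, I.IsMaximal → Infinite (R ⧸ I))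
    (q : QuadraticForm R (Fin m → R)) (M : Matrix (Fin m) (Fin m) R)
    (hM : ∀ x : Fin m → R, q x = qq M x) (n : ℕ) :
    ∀ p : R[X], p.Monic → p.natDegree = n → ∀ f : Fin m → R[X],
      IsUnit (resultant p (qq M f)) → Dp q n (resultant p (qq M f)) := by
  have hev : ∀ (f : Fin m → R[X]) (b : R), (qq M f).eval b = q (fun i => (f i).eval b) := by
    intro f b
    rw [hM]; exact qq_map M (aeval b) f
  induction n using Nat.strong_induction_on with
  | _ n ih =>
  intro p hp hpn f hu
  rcases n with _ | _ | k
  · obtain rfl := eq_one_of_monic_natDegree_zero hp hpn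
    simpa using Dp.one
  · have hX : p = X - C (- p.coeff 0) := by
      rw [C_neg, sub_neg_eq_add]; exact hp.eq_X_add_C hpn
    rw [hX, res_X_sub_C, hev]
    exact Dp.val _
  -- the main case, `n = k + 2`
  have hn0 : p.natDegree ≠ 0 := by omega
  set g : Fin m → R[X] := fun i => f i %ₘ p with hg
  have hgd : ∀ i, (g i).natDegree ≤ k + 1 := by
    intro i
    have := natDegree_modByMonic_lt (f i) hp (by rintro rfl; simp at hpn)
    show (f i %ₘ p).natDegree ≤ k + 1
    omega
  have hfg : resultant p (qq M f) = resultant p (qq M g) := by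
    refine res_congr hp (qq_dvd _ _ _ _ fun i => ⟨f i /ₘ p, ?_⟩)
    have := modByMonic_add_div (f i) p
    linear_combination -this
  rw [hfg] at hu ⊢
  obtain ⟨z, hpz, hqz⟩ := exists_z hs hres hp hn0 hu
  rw [hev] at hqz
  set q0 := q (fun i => (g i).eval z) with hq0
  obtain ⟨c, w, hcu, hwd, hwc, hwg⟩ := exists_w M hp hpn z hpz g hgd
  have hw : resultant p (qq M w) = resultant p c ^ 2 * resultant p (qq M g) := by
    rw [res_congr hp hwg, res_mul hp, pow_two, res_mul hp, pow_two]
  have huw : IsUnit (resultant p (qq M w)) := by rw [hw]; exact (hcu.pow 2).mul hu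
  suffices hmain : Dp q (k + 2) (resultant p (qq M w)) by
    rw [hw, mul_comm] at hmain
    exact (hmain.cancel (Dp.sq hqz _) (hcu.pow 2)).congr (by omega)
  set Q := qq M w with hQ
  set r := Q %ₘ p with hr
  set h := Q /ₘ p with hh
  have hQr : Q = r + p * h := (modByMonic_add_div Q p).symm
  have hQc : Q.coeff (2 * (k + 1)) = q0 := by
    rw [hQ, qq_coeff M (k + 1) w hwd, hq0, hM]; simp only [hwc]
  have hq00 : q0 ≠ 0 := hqz.ne_zero
  have hQd : Q.natDegree = 2 * (k + 1) :=
    natDegree_eq_of_le_of_coeff_ne_zero (qq_natDegree M (k + 1) w hwd) (by rwa [hQc])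
  have hhd : h.natDegree = k := by
    rw [hh, natDegree_divByMonic _ hp, hQd, hpn]; omega
  have hhl : h.coeff k = q0 := by
    have : h.leadingCoeff = Q.leadingCoeff := leadingCoeff_divByMonic_of_monic hp (by
      have hQ0 : Q ≠ 0 := by intro h0; rw [h0, coeff_zero] at hQc; exact hq00 hQc.symm
      rw [degree_eq_natDegree hp.ne_zero, degree_eq_natDegree hQ0, hpn, hQd]
      exact_mod_cast (by omega))
    rw [leadingCoeff, hhd, leadingCoeff, hQd, hQc] at this
    exact this
  obtain ⟨b, hpb, hrb, hΦ⟩ := exists_beta hs hres hp hn0 hQr huw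
  obtain ⟨ri, hri⟩ := hrb.exists_right_inv
  set ν : R := - (p.eval b * ri) with hν
  have hνu : IsUnit ν := (hpb.mul (IsUnit.of_mul_eq_one_right _ hri)).neg
  set p' : R[X] := p + C ν * r with hp'
  have hrd : r.degree < p.degree := degree_modByMonic_lt _ hp
  have hνr : (C ν * r).degree < p.degree := by
    rw [degree_C_mul hνu.ne_zero]; exact hrd
  have hp'm : p'.Monic := hp.add_of_left hνr
  have hp'n : p'.natDegree = k + 2 := by
    rw [← hpn]; exact natDegree_eq_of_degree_eq (degree_add_eq_left_of_degree_lt hνr)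
  have hp'b : p'.IsRoot b := by
    simp only [IsRoot, hp', eval_add, eval_mul, eval_C, hν]
    linear_combination (-p.eval b) * hri
  have hcr : C (r.eval b) * C ri = (1 : R[X]) := by rw [← C_mul, hri, C_1]
  have hup' : IsUnit (resultant p' Q) := by
    have e : C (r.eval b) * p - C (p.eval b) * r = C (r.eval b) * p' := by
      simp only [hp', hν, C_neg, C_mul]
      linear_combination (C (p.eval b) * r) * hcr
    rw [e, resultant_C_mul_left] at hΦ
    have := isUnit_of_mul_isUnit_right hΦ
    rwa [hpn, ← hp'n] at this
  -- split off the root `b`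
  set p'' := p' /ₘ (X - C b) with hp''
  have hfac : (X - C b) * p'' = p' := mul_divByMonic_eq_iff_isRoot.mpr hp'b
  have hp''m : p''.Monic := (monic_X_sub_C b).of_mul_monic_left (hfac ▸ hp'm)
  have hp''n : p''.natDegree = k + 1 := by
    rw [hp'', natDegree_divByMonic _ (monic_X_sub_C b), hp'n]; simp
  have hres' : resultant p' Q = Q.eval b * resultant p'' Q := by
    rw [← hfac, res_mul_left (monic_X_sub_C b) hp''m, res_X_sub_C]
  have hDp' : Dp q (k + 2) (resultant p' Q) := by
    rw [hres'] at hup' ⊢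
    have h1 := ih (k + 1) (by omega) p'' hp''m hp''n w (isUnit_of_mul_isUnit_right hup')
    rw [hQ, hev]
    exact ((Dp.val _).mul h1).congr (by omega)
  -- the cofactor
  obtain ⟨u, H, hH, hHm, hHn, hkey⟩ : ∃ (u : R) (H : R[X]), C ν * h - 1 = C u * H ∧ H.Monic ∧
      H.natDegree = k ∧ Dp q k (u ^ (k + 2) * ν ^ k) := by
    rcases Nat.eq_zero_or_pos k with hk | hk
    · subst hk
      refine ⟨ν * q0 - 1, 1, ?_, monic_one, natDegree_one, ?_⟩
      · rw [eq_C_of_natDegree_eq_zero hhd, hhl]; simp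
      · simpa using Dp.sq hqz _
    · have huu : IsUnit (ν * q0) := hνu.mul hqz
      obtain ⟨y, hy⟩ := huu.exists_right_inv
      have hd : (C ν * h - 1).natDegree ≤ k :=
        (natDegree_sub_le _ _).trans (max_le ((natDegree_C_mul_le _ _).trans hhd.le) (by simp))
      have hcf : (C ν * h - 1).coeff k = ν * q0 := by
        rw [coeff_sub, coeff_C_mul, hhl, coeff_one, if_neg hk.ne', sub_zero]
      have hyc : (C y * (C ν * h - 1)).coeff k = 1 := by
        rw [coeff_C_mul, hcf, mul_comm, hy]
      have hyd : (C y * (C ν * h - 1)).natDegree ≤ k := (natDegree_C_mul_le _ _).trans hd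
      refine ⟨ν * q0, C y * (C ν * h - 1), ?_, monic_of_natDegree_le_of_coeff_eq_one k hyd hyc,
        natDegree_eq_of_le_of_coeff_ne_zero hyd (by rw [hyc]; exact one_ne_zero), ?_⟩
      · rw [← mul_assoc, ← C_mul, hy, C_1, one_mul]
      · have h1 := (Dp.sq hqz (ν ^ (k + 1))).mul ((Dp.val (q := q) (fun i => (g i).eval z)).pow (k + 2))
        rw [← hq0] at h1
        convert h1.congr (j := k) (by omega) using 1
        ring
  have hid : C ν * Q = p' + p * (C u * H) := by
    rw [← hH, hp']
    linear_combination (C ν) * hQr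
  have e4 : resultant p' Q = resultant p Q * (u ^ (k + 2) * ν ^ k * resultant H Q) :=
    cofactor hp hp'm hHm hpn hp'n hHn hνu hid
  have hu4 : IsUnit (u ^ (k + 2) * ν ^ k * resultant H Q) := isUnit_of_mul_isUnit_right (e4 ▸ hup')
  have hDH := ih k (by omega) H hHm hHn w (isUnit_of_mul_isUnit_right hu4)
  rw [e4] at hDp'
  exact (hDp'.cancel (hkey.mul hDH) hu4).congr (by omega)

end key

section nrm

lemma det_aeval_field {K : Type u} [Field K] [IsAlgClosed K] {n : ℕ} (A : Matrix (Fin n) (Fin n) K)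
    (g : K[X]) : (aeval A g).det = resultant A.charpoly g := by
  have hA := A.charpoly_monic
  have hd : A.charpoly.natDegree = n := by simp
  have hsp := IsAlgClosed.splits g
  induction hsp using Submonoid.closure_induction with
  | mem g hg =>
    rcases hg with ⟨u, rfl⟩ | ⟨u, rfl⟩
    · rw [res_C, hd, aeval_C, Matrix.algebraMap_eq_diagonal]
      simp
    · have : X + C u = X - C (-u) := by simp
      have h3 : resultant A.charpoly (X - C (-u)) = (-1) ^ n * A.charpoly.eval (-u) := by
        rw [← res_X_sub_C]
        calc _ = _ := res_comm _ _
          _ = _ := by rw [hd, natDegree_X_sub_C, mul_one]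
      rw [this, h3, Matrix.eval_charpoly]
      have h2 : aeval A (X - C (-u)) = - (Matrix.scalar (Fin n) (-u) - A) := by
        simp [Matrix.algebraMap_eq_diagonal, sub_eq_add_neg]
      rw [h2, Matrix.det_neg]; simp
  | one => rw [← C_1, res_C]; simp
  | mul a b _ _ ha hb => rw [map_mul, Matrix.det_mul, ha, hb, res_mul hA]

lemma det_aeval {R : Type u} [CommRing R] [IsDomain R] {n : ℕ} (A : Matrix (Fin n) (Fin n) R)
    (g : R[X]) : (aeval A g).det = resultant A.charpoly g := by
  let K := AlgebraicClosure (FractionRing R)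
  let φ : R →+* K := algebraMap R K
  have hφ : Function.Injective φ := by
    show Function.Injective (algebraMap R K)
    rw [IsScalarTower.algebraMap_eq R (FractionRing R) K]
    exact (algebraMap (FractionRing R) K).injective.comp (IsFractionRing.injective R _)
  apply hφ
  have h1 := det_aeval_field (A.map φ) (g.map φ)
  have e1 : resultant (A.map φ).charpoly (g.map φ) = φ (resultant A.charpoly g) := by
    rw [Matrix.charpoly_map, natDegree_map_eq_of_injective hφ, natDegree_map_eq_of_injective hφ,
      resultant_map_map]
  have e2 : aeval (A.map φ) (g.map φ) = (aeval A g).map φ := by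
    have := map_aeval_eq_aeval_map (R := R) (S := Matrix (Fin n) (Fin n) R) (T := K)
      (U := Matrix (Fin n) (Fin n) K) (φ := φ) (ψ := φ.mapMatrix) (by
        ext r i j
        simp [Matrix.algebraMap_eq_diagonal, Matrix.diagonal_apply, apply_ite φ]) g A
    exact this.symm
  rw [← e1, ← h1, e2, RingHom.map_det]; rfl

lemma norm_aeval {R S : Type u} [CommRing R] [IsDomain R] [CommRing S] [Algebra R S] {n : ℕ}
    (b : Module.Basis (Fin n) R S) (x : S) (g : R[X]) :
    Algebra.norm R (aeval x g) = resultant (Algebra.leftMulMatrix b x).charpoly g := by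
  rw [Algebra.norm_eq_matrix_det b, ← det_aeval, ← aeval_algHom_apply]

end nrm
section prim

lemma exists_basis {R S : Type u} [CommRing R] [IsDomain R]
    (hs : {I : Ideal R | I.IsMaximal}.Finite)
    [CommRing S] [Algebra R S] [Algebra.Etale R S] [Module.Finite R S]
    (n : ℕ) (hrank : Module.finrank R S = n) : Nonempty (Module.Basis (Fin n) R S) := by
  have : Finite (MaximalSpectrum R) := by
    have := hs.to_subtype
    exact Finite.of_injective (β := {I : Ideal R | I.IsMaximal}) (fun P => ⟨P.1, P.2⟩)
      (fun P Q h => MaximalSpectrum.ext (by simpa using h))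
  have : Module.Flat R S := inferInstance
  refine Module.nonempty_basis_of_flat_of_finrank_eq R S n fun P => ?_
  have := P.2
  have : P.1.IsPrime := inferInstance
  let _ := Ideal.Quotient.field P.1
  rw [← hrank, ← Ideal.finrank_fiber_eq_finrank P.1]
  rw [← Module.finrank_baseChange (R := P.1.ResidueField) (S := R ⧸ P.1)
    (M' := (R ⧸ P.1) ⊗[R] S)]
  exact (TensorProduct.AlgebraTensorModule.cancelBaseChange R (R ⧸ P.1) P.1.ResidueField
    P.1.ResidueField S).finrank_eq

lemma exists_sigma {R S : Type u} [CommRing R]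
    [CommRing S] [Algebra R S] [Algebra.Etale R S] {n : ℕ} (b : Module.Basis (Fin n) R S)
    (I : Ideal R) (hI : I.IsMaximal) :
    ∃ (L : Type u) (_ : Field L) (φ : R →+* L) (σ : Fin n → S →+* L), RingHom.ker φ = I ∧
      (∀ i r, σ i (algebraMap R S r) = φ r) ∧ ∀ i j, i ≠ j → ∃ l, σ i (b l) ≠ σ j (b l) := by
  let _ := Ideal.Quotient.field I
  let L := AlgebraicClosure (R ⧸ I)
  let φ : R →+* L := (algebraMap (R ⧸ I) L).comp (Ideal.Quotient.mk I)
  let _ : Algebra R L := φ.toAlgebra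
  let A := L ⊗[R] S
  have : Algebra.Etale L A := inferInstance
  let e := Algebra.FormallyEtale.equivPiOfIsSepClosed L A
  let bL : Module.Basis (Fin n) L A := Algebra.TensorProduct.basis L b
  have : Module.Finite L A := Module.Finite.of_basis bL
  have : IsArtinianRing A := isArtinian_of_tower L inferInstance
  have hfin : Finite (PrimeSpectrum A) := inferInstance
  have := Fintype.ofFinite (PrimeSpectrum A)
  have hcard : Fintype.card (PrimeSpectrum A) = n := by
    have h1 := e.toLinearEquiv.finrank_eq
    rw [Module.finrank_eq_card_basis bL, Module.finrank_fintype_fun_eq_card, Fintype.card_fin] at h1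
    exact h1.symm
  let ε : Fin n ≃ PrimeSpectrum A := (Fintype.equivFinOfCardEq hcard).symm
  let σ : Fin n → S →+* L := fun i =>
    ((Pi.evalRingHom (fun _ => L) (ε i)).comp (e : A →+* (PrimeSpectrum A → L))).comp
      (Algebra.TensorProduct.includeRight (R := R) (A := L) (B := S) : S →+* A)
  have hσ : ∀ i s, σ i s = e ((1 : L) ⊗ₜ[R] s) (ε i) := fun i s => rfl
  refine ⟨L, inferInstance, φ, σ, ?_, ?_, ?_⟩
  · ext r
    simp [φ, RingHom.mem_ker, Ideal.Quotient.eq_zero_iff_mem]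
  · intro i r
    have : (1 : L) ⊗ₜ[R] (algebraMap R S r) = algebraMap L A (φ r) := by
      rw [Algebra.algebraMap_eq_smul_one, TensorProduct.tmul_smul, Algebra.TensorProduct.algebraMap_apply,
        TensorProduct.smul_tmul', Algebra.smul_def, mul_one]
      rfl
    rw [hσ, this, e.commutes]; rfl
  · intro i j hij
    by_contra! h
    have key : ∀ t : A, e t (ε i) = e t (ε j) := by
      intro t
      rw [← bL.sum_repr t]
      simp only [map_sum, map_smul, Finset.sum_apply, Pi.smul_apply]
      refine Finset.sum_congr rfl fun l _ => ?_
      congr 1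
      have := h l
      rw [hσ, hσ] at this
      have hb : bL l = (1 : L) ⊗ₜ[R] b l := Algebra.TensorProduct.basis_apply b l
      rw [hb]; exact this
    classical
    have h2 := key (e.symm (Pi.single (ε i) 1))
    simp [Pi.single_apply, hij.symm] at h2

noncomputable def xz {R S : Type u} [CommRing R] [CommRing S] [Algebra R S] {n : ℕ}
    (b : Module.Basis (Fin n) R S) (z : R) : S := ∑ l : Fin n, algebraMap R S (z ^ (l : ℕ)) * b l

lemma sigma_xz {R S : Type u} [CommRing R] [CommRing S] [Algebra R S] {n : ℕ}
    (b : Module.Basis (Fin n) R S) (z : R) {L : Type u} [Field L] (φ : R →+* L) (σ : S →+* L)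
    (h : ∀ r, σ (algebraMap R S r) = φ r) :
    σ (xz b z) = ∑ l : Fin n, φ z ^ (l : ℕ) * σ (b l) := by
  simp only [xz, map_sum, map_mul, h, map_pow]

lemma exists_prim {R S : Type u} [CommRing R] 
    (hs : {I : Ideal R | I.IsMaximal}.Finite)
    (hres : ∀ I : Ideal R, I.IsMaximal → Infinite (R ⧸ I))
    [CommRing S] [Algebra R S] [Algebra.Etale R S] {n : ℕ} (b : Module.Basis (Fin n) R S) :
    ∃ x : S, ∀ s : S, ∃ g : R[X], aeval x g = s := by
  obtain ⟨z, hz⟩ := crt hs (fun I z => ∃ (L : Type u) (_ : Field L) (φ : R →+* L)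
      (σ : Fin n → S →+* L), RingHom.ker φ = I ∧
      (∀ i r, σ i (algebraMap R S r) = φ r) ∧ Function.Injective fun i => σ i (xz b z)) (by
    intro I hI
    obtain ⟨L, _, φ, σ, hk, hσ, hsep⟩ := exists_sigma b I hI
    let F : Fin n → Fin n → L[X] := fun i j => ∑ l : Fin n, C (σ i (b l) - σ j (b l)) * X ^ (l : ℕ)
    have hF : ∀ i j, i ≠ j → F i j ≠ 0 := by
      intro i j hij h0
      obtain ⟨l, hl⟩ := hsep i j hij
      have := congrArg (fun p => coeff p (l : ℕ)) h0
      simp only [F, finsetSum_coeff, coeff_C_mul, coeff_X_pow, coeff_zero, Fin.val_inj] at this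
      simp at this
      exact hl (sub_eq_zero.mp this)
    let G : L[X] := ∏ i, ∏ j, if i = j then 1 else F i j
    have hG : G ≠ 0 := by
      refine Finset.prod_ne_zero_iff.mpr fun i _ => Finset.prod_ne_zero_iff.mpr fun j _ => ?_
      split_ifs with h
      · exact one_ne_zero
      · exact hF i j h
    have hinf : (Set.range φ).Infinite := by
      have := hres I hI
      rw [← hk] at this
      refine (Set.infinite_range_of_injective (RingHom.kerLift_injective φ)).mono ?_
      rintro _ ⟨y, rfl⟩
      obtain ⟨r, rfl⟩ := Ideal.Quotient.mk_surjective y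
      exact ⟨r, rfl⟩
    obtain ⟨y, ⟨z, rfl⟩, hy⟩ : ∃ y ∈ Set.range φ, G.eval y ≠ 0 := by
      by_contra! h
      exact hG (eq_zero_of_infinite_isRoot G (hinf.mono h))
    refine ⟨z, L, inferInstance, φ, σ, hk, hσ, fun i j hij => ?_⟩
    by_contra hne
    apply hy
    simp only [G, eval_prod]
    refine Finset.prod_eq_zero (Finset.mem_univ i) (Finset.prod_eq_zero (Finset.mem_univ j) ?_)
    rw [if_neg hne]
    simp only [sigma_xz b z φ _ (hσ _)] at hij
    simp only [F, eval_finsetSum, eval_mul, eval_C, eval_pow, eval_X, sub_mul, Finset.sum_sub_distrib]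
    rw [sub_eq_zero]
    simpa only [mul_comm] using hij) (by
    rintro I hI z z' hzz ⟨L, _, φ, σ, hk, hσ, hinj⟩
    refine ⟨L, inferInstance, φ, σ, hk, hσ, ?_⟩
    have : φ z = φ z' := by
      rw [← hk, RingHom.mem_ker, map_sub] at hzz
      exact sub_eq_zero.mp hzz
    simp only [sigma_xz b _ φ _ (hσ _)] at hinj ⊢
    rwa [this])
  set x := xz b z
  let D : Matrix (Fin n) (Fin n) R := Matrix.of fun j l => b.repr (x ^ (j : ℕ)) l
  have hD : IsUnit D.det := by
    refine isUnit_of_max fun I hI hdet => ?_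
    obtain ⟨L, _, φ, σ, hk, hσ, hinj⟩ := hz I hI
    rw [← hk, RingHom.mem_ker, RingHom.map_det] at hdet
    have hV : Matrix.vandermonde (fun i => σ i x) =
        (Matrix.of fun i l => σ i (b l)) * (φ.mapMatrix D).transpose := by
      ext i j
      rw [Matrix.vandermonde_apply, Matrix.mul_apply, ← map_pow]
      conv_lhs => rw [← b.sum_repr (x ^ (j : ℕ))]
      simp [Algebra.smul_def, hσ, D, mul_comm]
    have := Matrix.det_vandermonde_ne_zero_iff.mpr hinj
    rw [hV, Matrix.det_mul, Matrix.det_transpose, hdet, mul_zero] at this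
    exact this rfl
  refine ⟨x, fun s => ?_⟩
  -- `b` is in the span of the powers
  have hb : ∀ l, b l = ∑ j : Fin n, algebraMap R S (D⁻¹ l j) * x ^ (j : ℕ) := by
    intro l
    have hx : ∀ j : Fin n, x ^ (j : ℕ) = ∑ k, algebraMap R S (D j k) * b k := by
      intro j
      conv_lhs => rw [← b.sum_repr (x ^ (j : ℕ))]
      simp [Algebra.smul_def, D]
    simp only [hx, Finset.mul_sum]
    rw [Finset.sum_comm]
    have h1 : ∀ k, ∑ j, algebraMap R S (D⁻¹ l j) * (algebraMap R S (D j k) * b k) =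
        algebraMap R S ((D⁻¹ * D) l k) * b k := by
      intro k
      simp [Matrix.mul_apply, Finset.sum_mul, mul_assoc]
    simp only [h1, Matrix.nonsing_inv_mul D hD, Matrix.one_apply]
    simp
  refine ⟨∑ l, C (b.repr s l) * ∑ j : Fin n, C (D⁻¹ l j) * X ^ (j : ℕ), ?_⟩
  simp only [map_sum, map_mul, aeval_C, map_pow, aeval_X, ← hb]
  conv_rhs => rw [← b.sum_repr s]
  simp [Algebra.smul_def]

end prim
section fin

noncomputable def Mq {R : Type u} [CommRing R] [Invertible (2 : R)] {m : ℕ} (q : QuadraticForm R (Fin m → R)) :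
    Matrix (Fin m) (Fin m) R :=
  fun i j => QuadraticMap.associated q (Pi.single i 1) (Pi.single j 1)

lemma Mq_spec {R : Type u} [CommRing R] [Invertible (2 : R)] {m : ℕ}
    (q : QuadraticForm R (Fin m → R)) (x : Fin m → R) : q x = qq (Mq q) x := by
  have h := QuadraticMap.associated_eq_self_apply R q x
  rw [← h]
  have hx : x = ∑ i, x i • (Pi.single i 1 : Fin m → R) := by
    ext j; simp [Pi.single_apply]
  conv_lhs => rw [hx]
  simp only [map_sum, LinearMap.sum_apply, map_smul, LinearMap.smul_apply, smul_eq_mul, qq, Mq, Finset.mul_sum]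
  rw [Finset.sum_comm]
  refine Finset.sum_congr rfl fun i _ => Finset.sum_congr rfl fun j _ => ?_
  simp only [Algebra.algebraMap_self, RingHom.id_apply]
  ring

lemma baseChange_spec {R S : Type u} [CommRing R] [Invertible (2 : R)] [CommRing S] [Algebra R S]
    {m : ℕ} (q : QuadraticForm R (Fin m → R)) (w : S ⊗[R] (Fin m → R)) :
    ∃ c : Fin m → S, q.baseChange S w = qq (Mq q) c := by
  let bS : Module.Basis (Fin m) S (S ⊗[R] (Fin m → R)) :=
    Algebra.TensorProduct.basis S (Pi.basisFun R (Fin m))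
  have : Invertible (2 : S) := by
    have : (2 : S) = algebraMap R S 2 := (map_ofNat (algebraMap R S) 2).symm
    rw [this]; exact Invertible.map (algebraMap R S) 2
  refine ⟨fun i => bS.repr w i, ?_⟩
  have h := QuadraticMap.associated_eq_self_apply S (q.baseChange S) w
  rw [← h, QuadraticForm.associated_baseChange]
  conv_lhs => rw [← bS.sum_repr w]
  simp only [map_sum, LinearMap.sum_apply, map_smul, LinearMap.smul_apply, smul_eq_mul, qq, Mq, Finset.mul_sum]
  rw [Finset.sum_comm]
  refine Finset.sum_congr rfl fun i _ => Finset.sum_congr rfl fun j _ => ?_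
  simp [bS, Algebra.smul_def]
  ring

end fin

end NormPr

/-- **Norm principle for even products.** Let `R` be a semi-local
Noetherian domain with infinite residue fields of characteristic `≠ 2`, `S` a finite étale
`R`-algebra of degree `n`, and `q` a quadratic space over `R`.  Then the norm maps
`D⁰_q(S)` (even products of units represented by `q_S`) into `D⁰_q(R)`; moreover the norm
of any unit represented by `q_S` is a product of `l` units represented by `q` with
`l ≡ n (mod 2)`. -/
theorem norm_principle_even {R S : Type u} [CommRing R] [IsDomain R] [IsNoetherianRing R]
    [Invertible (2 : R)]
    (hsemilocal : {I : Ideal R | I.IsMaximal}.Finite)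
    (hres : ∀ I : Ideal R, I.IsMaximal → Infinite (R ⧸ I))
    [CommRing S] [Algebra R S] [Algebra.Etale R S] [Module.Finite R S]
    (n : ℕ) (hrank : Module.finrank R S = n)
    {m : ℕ} (q : QuadraticForm R (Fin m → R)) :
    (∀ s : Sˣ,
      (∃ (l : ℕ) (v : Fin (2 * l) → S ⊗[R] (Fin m → R)),
          (s : S) = ∏ j, q.baseChange S (v j)) →
      ∃ (l : ℕ) (w : Fin (2 * l) → Fin m → R),
          Algebra.norm R (s : S) = ∏ j, q (w j)) ∧
    (∀ a : Sˣ, (∃ w : S ⊗[R] (Fin m → R), q.baseChange S w = (a : S)) →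
      ∃ (l : ℕ) (w : Fin l → Fin m → R),
          l % 2 = n % 2 ∧ Algebra.norm R (a : S) = ∏ j, q (w j)) := by
  obtain ⟨b⟩ := NormPr.exists_basis hsemilocal n hrank (S := S)
  obtain ⟨x, hx⟩ := NormPr.exists_prim hsemilocal hres b
  have main : ∀ a : Sˣ, (∃ w : S ⊗[R] (Fin m → R), q.baseChange S w = (a : S)) →
      NormPr.Dp q n (Algebra.norm R (a : S)) := by
    rintro a ⟨w, hw⟩
    obtain ⟨c, hc⟩ := NormPr.baseChange_spec q w
    choose f hf using fun i => hx (c i)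
    have ha : (a : S) = Polynomial.aeval x (NormPr.qq (NormPr.Mq q) f) := by
      rw [NormPr.qq_map]; simp only [hf]; rw [← hw, hc]
    have hu : IsUnit (Algebra.norm R (a : S)) := a.isUnit.map (Algebra.norm R)
    rw [ha, NormPr.norm_aeval b] at hu ⊢
    exact NormPr.key hsemilocal hres q (NormPr.Mq q) (NormPr.Mq_spec q) n _
      (Matrix.charpoly_monic _) (by simp) f hu
  constructor
  · rintro s ⟨l, v, hv⟩
    have hprod : ∀ t : Finset (Fin (2 * l)),
        NormPr.Dp q (t.card * n) (∏ j ∈ t, Algebra.norm R (q.baseChange S (v j))) := by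
      intro t
      induction t using Finset.induction_on with
      | empty => simpa using NormPr.Dp.one
      | insert j t hj ih =>
        rw [Finset.prod_insert hj, Finset.card_insert_of_notMem hj]
        have hju : IsUnit (q.baseChange S (v j)) :=
          isUnit_of_dvd_unit (hv ▸ Finset.dvd_prod_of_mem _ (Finset.mem_univ j)) s.isUnit
        have h1 := main hju.unit ⟨v j, rfl⟩
        exact (h1.mul ih).congr (by ring_nf)
    obtain ⟨L, hL, hLp⟩ := hprod Finset.univ
    rw [← map_prod, ← hv] at hLp
    have hLe : L.length % 2 = 0 := by
      rw [hL, Finset.card_univ, Fintype.card_fin, mul_assoc, Nat.mul_mod_right]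
    obtain ⟨k, hk⟩ := Nat.dvd_of_mod_eq_zero hLe
    refine ⟨k, fun j => L.get (j.cast hk.symm), ?_⟩
    rw [hLp, ← Fin.prod_univ_fun_getElem]
    exact (Fintype.prod_equiv (finCongr hk.symm) _ _ fun j => rfl).symm
  · intro a ha
    obtain ⟨L, hL, hLp⟩ := main a ha
    refine ⟨L.length, L.get, hL, ?_⟩
    rw [hLp, ← Fin.prod_univ_fun_getElem]
    rfl
end

section
/- Let R be a local ring with infinite residue field of characteristic ≠ 2, S = R[t]/(f_α) a finite étale R-algebra of degree n with primitive invertible element α, and (V, q) a quadratic space over R. If α·q_S(v) = 1 for some v ∈ V ⊗_R S, then N^S_R(q_S(v)) ∈ D_q(R). -/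
open Polynomial

universe u

/-- The quadratic form on `A^m` attached to a symmetric matrix `M` over `R`, base-changed
to an `R`-algebra `A`: `q(v) = ∑ᵢⱼ M i j * v i * v j`. -/
def matrixQF {R : Type u} [CommRing R] {m : ℕ} (M : Matrix (Fin m) (Fin m) R)
    (A : Type u) [CommRing A] [Algebra R A] (v : Fin m → A) : A :=
  ∑ i : Fin m, ∑ j : Fin m, algebraMap R A (M i j) * v i * v j

namespace PR
noncomputable section

variable {A B : Type*} [CommRing A] [CommRing B]

/-- the quadratic form over polynomials -/
def pq {m : ℕ} (M : Matrix (Fin m) (Fin m) A) (w : Fin m → A[X]) : A[X] :=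
  ∑ i, ∑ j, C (M i j) * w i * w j

def rho (x y : A) : A[X] := ((X - C x) * (X - C y)) ^ 2 * X

def uu {m : ℕ} (f : A[X]) (v : Fin m → A[X]) (x y : A) (i : Fin m) : A[X] :=
  (f /ₘ (X - C x)) * (f /ₘ (X - C y)) * v i

def Pm (N : ℕ) (f ρ : A[X]) : Matrix (Fin N) (Fin N) A :=
  Matrix.of fun i j => ((ρ ^ (j : ℕ)) %ₘ f).coeff i

def Lm (N : ℕ) (f ρ : A[X]) : Matrix (Fin N) (Fin N) A :=
  Matrix.of fun i j => ((ρ * X ^ (j : ℕ)) %ₘ f).coeff i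

def sol (N : ℕ) (f ρ p : A[X]) : A[X] :=
  ∑ j : Fin N, C (((Pm N f ρ).adjugate.mulVec fun l : Fin N => (p %ₘ f).coeff l) j) * X ^ (j : ℕ)

def om {m : ℕ} (N : ℕ) (f : A[X]) (v : Fin m → A[X]) (x y : A) (i : Fin m) : A[X] :=
  sol N f (rho x y) (uu f v x y i)

def Phi {m : ℕ} (N : ℕ) (M : Matrix (Fin m) (Fin m) A) (f : A[X]) (v : Fin m → A[X])
    (x y : A) : A[X] :=
  X * pq M (om N f v x y) - C (((Pm N f (rho x y)).det * (f.eval x * f.eval y)) ^ 2)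

def HH {m : ℕ} (N : ℕ) (M : Matrix (Fin m) (Fin m) A) (f : A[X]) (v : Fin m → A[X])
    (x y : A) : A[X] :=
  Phi N M f v x y /ₘ (Lm N f (rho x y)).charpoly

def GG {m : ℕ} (n : ℕ) (M : Matrix (Fin m) (Fin m) A) (f : A[X]) (v : Fin m → A[X])
    (x y : A) : A :=
  (Pm (n + 1) f (rho x y)).det * (HH (n + 1) M f v x y).coeff n *
    resultant (HH (n + 1) M f v x y) (HH (n + 1) M f v x y).derivative n n

/-! naturality -/
section nat
variable (φ : A →+* B)

lemma pq_map {m : ℕ} (M : Matrix (Fin m) (Fin m) A) (w : Fin m → A[X]) :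
    (pq M w).map φ = pq (M.map φ) (fun i => (w i).map φ) := by
  simp [pq, Polynomial.map_sum]

lemma rho_map (x y : A) : (rho x y).map φ = rho (φ x) (φ y) := by simp [rho]

lemma uu_map {m : ℕ} (f : A[X]) (v : Fin m → A[X]) (x y : A) (i : Fin m) :
    (uu f v x y i).map φ = uu (f.map φ) (fun i => (v i).map φ) (φ x) (φ y) i := by
  simp [uu, map_divByMonic _ (monic_X_sub_C _)]

lemma Pm_map (N : ℕ) (f ρ : A[X]) (hf : f.Monic) :
    (Pm N f ρ).map φ = Pm N (f.map φ) (ρ.map φ) := by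
  ext i j
  simp [Pm, ← Polynomial.map_pow, ← map_modByMonic _ hf]

lemma Lm_map (N : ℕ) (f ρ : A[X]) (hf : f.Monic) :
    (Lm N f ρ).map φ = Lm N (f.map φ) (ρ.map φ) := by
  ext i j
  have : ρ.map φ * X ^ (j : ℕ) = (ρ * X ^ (j : ℕ)).map φ := by simp
  rw [Lm, Lm, Matrix.map_apply, Matrix.of_apply, Matrix.of_apply, this, ← map_modByMonic _ hf, coeff_map]

lemma detPm_map (N : ℕ) (f ρ : A[X]) (hf : f.Monic) :
    φ (Pm N f ρ).det = (Pm N (f.map φ) (ρ.map φ)).det := by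
  rw [← Pm_map φ N f ρ hf, RingHom.map_det]; rfl

lemma sol_map (N : ℕ) (f ρ p : A[X]) (hf : f.Monic) :
    (sol N f ρ p).map φ = sol N (f.map φ) (ρ.map φ) (p.map φ) := by
  have h : (Pm N (f.map φ) (ρ.map φ)).adjugate = (Pm N f ρ).adjugate.map φ := by
    rw [← Pm_map φ N f ρ hf]
    exact (RingHom.map_adjugate φ (Pm N f ρ)).symm
  simp [sol, Polynomial.map_sum, h, ← map_modByMonic _ hf, Matrix.mulVec, dotProduct]

lemma om_map {m : ℕ} (N : ℕ) (f : A[X]) (v : Fin m → A[X]) (x y : A) (i : Fin m) (hf : f.Monic) :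
    (om N f v x y i).map φ = om N (f.map φ) (fun i => (v i).map φ) (φ x) (φ y) i := by
  simp [om, sol_map φ _ _ _ _ hf, rho_map, uu_map]

lemma Phi_map {m : ℕ} (N : ℕ) (M : Matrix (Fin m) (Fin m) A) (f : A[X]) (v : Fin m → A[X])
    (x y : A) (hf : f.Monic) :
    (Phi N M f v x y).map φ
      = Phi N (M.map φ) (f.map φ) (fun i => (v i).map φ) (φ x) (φ y) := by
  simp [Phi, pq_map, om_map φ _ _ _ _ _ _ hf, detPm_map φ _ _ _ hf, rho_map]

lemma HH_map {m : ℕ} (N : ℕ) (M : Matrix (Fin m) (Fin m) A) (f : A[X]) (v : Fin m → A[X])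
    (x y : A) (hf : f.Monic) :
    (HH N M f v x y).map φ
      = HH N (M.map φ) (f.map φ) (fun i => (v i).map φ) (φ x) (φ y) := by
  rw [HH, map_divByMonic _ (Matrix.charpoly_monic _), Phi_map φ _ _ _ _ _ _ hf,
    ← Matrix.charpoly_map, Lm_map φ _ _ _ hf, rho_map, HH]

lemma GG_map {m : ℕ} (n : ℕ) (M : Matrix (Fin m) (Fin m) A) (f : A[X]) (v : Fin m → A[X])
    (x y : A) (hf : f.Monic) :
    φ (GG n M f v x y)
      = GG n (M.map φ) (f.map φ) (fun i => (v i).map φ) (φ x) (φ y) := by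
  rw [GG, map_mul, map_mul, detPm_map φ _ _ _ hf, ← resultant_map_map, ← derivative_map,
    HH_map φ _ _ _ _ _ _ hf, rho_map, ← coeff_map, HH_map φ _ _ _ _ _ _ hf, GG]

end nat

/-! general facts -/

lemma pq_dvd {m : ℕ} (M : Matrix (Fin m) (Fin m) A) (f : A[X]) (w w' : Fin m → A[X])
    (h : ∀ i, f ∣ w i - w' i) : f ∣ pq M w - pq M w' := by
  simp only [pq, ← Finset.sum_sub_distrib]
  refine Finset.dvd_sum fun i _ => Finset.dvd_sum fun j _ => ?_
  have : C (M i j) * w i * w j - C (M i j) * w' i * w' j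
    = C (M i j) * w j * (w i - w' i) + C (M i j) * w' i * (w j - w' j) := by ring
  rw [this]
  exact dvd_add ((h i).mul_left _) ((h j).mul_left _)

lemma pq_smul {m : ℕ} (M : Matrix (Fin m) (Fin m) A) (a : A[X]) (w : Fin m → A[X]) :
    pq M (fun i => a * w i) = a ^ 2 * pq M w := by
  simp only [pq, Finset.mul_sum]
  refine Finset.sum_congr rfl fun i _ => Finset.sum_congr rfl fun j _ => by ring

lemma pq_comp {m : ℕ} (M : Matrix (Fin m) (Fin m) A) (w : Fin m → A[X]) (ρ : A[X]) :
    (pq M w).comp ρ = pq M (fun i => (w i).comp ρ) := by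
  simp [pq, Polynomial.sum_comp]

lemma sum_trunc (N : ℕ) (p : A[X]) (h : p.degree < N) :
    ∑ i : Fin N, C (p.coeff i) * X ^ (i : ℕ) = p := by
  have := (sum_fin (fun i c => monomial i c) (by simp) h).trans (sum_monomial_eq _)
  simpa [C_mul_X_pow_eq_monomial] using this

lemma key (N : ℕ) (f ρ : A[X]) (c : Fin N → A) (i : Fin N) :
    ((∑ j : Fin N, C (c j) * ρ ^ (j : ℕ)) %ₘ f).coeff i = ((Pm N f ρ).mulVec c) i := by
  have h := map_sum (Polynomial.modByMonicHom f) (fun j : Fin N => C (c j) * ρ ^ (j : ℕ))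
    Finset.univ
  simp only [Polynomial.modByMonicHom_apply] at h
  rw [h, finsetSum_coeff]
  simp only [Matrix.mulVec, dotProduct, Pm, Matrix.of_apply]
  refine Finset.sum_congr rfl fun j _ => ?_
  rw [← smul_eq_C_mul, smul_modByMonic, coeff_smul, smul_eq_mul, mul_comm]

lemma dvd_of_coeff [Nontrivial A] (N : ℕ) (f p : A[X]) (hf : f.Monic) (hN : f.natDegree = N)
    (h : ∀ i : Fin N, (p %ₘ f).coeff i = 0) : f ∣ p := by
  rw [← modByMonic_eq_zero_iff_dvd hf]
  have hd : (p %ₘ f).degree < N := by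
    rw [← hN, ← degree_eq_natDegree hf.ne_zero]; exact degree_modByMonic_lt _ hf
  rw [← sum_trunc N _ hd]
  simp [h]

lemma sol_degree (N : ℕ) (f ρ p : A[X]) : (sol N f ρ p).degree < N := degree_sum_fin_lt _

lemma sol_spec [Nontrivial A] (N : ℕ) (f ρ p : A[X]) (hf : f.Monic) (hN : f.natDegree = N) :
    f ∣ (sol N f ρ p).comp ρ - C (Pm N f ρ).det * p := by
  refine dvd_of_coeff N f _ hf hN fun i => ?_
  rw [sub_modByMonic, coeff_sub, sol, Polynomial.sum_comp]
  simp only [mul_comp, C_comp, pow_comp, X_comp]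
  rw [key, Matrix.mulVec_mulVec, Matrix.mul_adjugate, ← smul_eq_C_mul, smul_modByMonic,
    coeff_smul, Matrix.smul_mulVec, Matrix.one_mulVec]
  simp

lemma comp_inj [Nontrivial A] (N : ℕ) (f ρ p : A[X]) (hf : f.Monic)
    (hD : IsUnit (Pm N f ρ).det) (hp : p.degree < N) (h : f ∣ p.comp ρ) : p = 0 := by
  rw [← sum_trunc N p hp] at h
  rw [Polynomial.sum_comp] at h
  simp only [mul_comp, C_comp, pow_comp, X_comp] at h
  rw [← modByMonic_eq_zero_iff_dvd hf] at h
  have h2 : (Pm N f ρ).mulVec (fun j => p.coeff j) = 0 := by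
    ext i
    rw [← key, h]; simp
  have h3 : (fun j : Fin N => p.coeff j) = 0 := by
    have := Matrix.mulVec_injective_of_isUnit ((Matrix.isUnit_iff_isUnit_det _).2 hD)
    apply this
    simpa using h2
  rw [← sum_trunc N p hp]
  refine Finset.sum_eq_zero fun j _ => ?_
  have := congrFun h3 j
  simp only [Pi.zero_apply] at this
  simp [this]

lemma Lm_eq (N : ℕ) (f ρ : A[X]) (hf : f.Monic) (hN : f.natDegree = N) :
    Lm N f ρ = (Algebra.leftMulMatrix ((AdjoinRoot.powerBasisAux' hf).reindex (finCongr hN))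
      (AdjoinRoot.mk f ρ)) := by
  subst hN
  ext i j
  rw [Algebra.leftMulMatrix_eq_repr_mul]
  have : ((AdjoinRoot.powerBasisAux' hf).reindex (finCongr rfl)) j
      = AdjoinRoot.mk f (X ^ (j : ℕ)) := by
    have := (AdjoinRoot.powerBasis' hf).basis_eq_pow j
    simp only [AdjoinRoot.powerBasis'] at this
    simp only [Module.Basis.coe_reindex, finCongr_refl, Equiv.refl_symm, Equiv.coe_refl,
      Function.comp_id, map_pow, AdjoinRoot.mk_X]
    exact this
  rw [this, ← map_mul]
  simp [Lm]
  rfl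

lemma Lm_det (N : ℕ) (f ρ : A[X]) (hf : f.Monic) (hN : f.natDegree = N) :
    (Lm N f ρ).det = Algebra.norm A (AdjoinRoot.mk f ρ) := by
  rw [Lm_eq N f ρ hf hN, ← Algebra.norm_eq_matrix_det]

lemma Lm_charpoly (N : ℕ) (f ρ : A[X]) (hf : f.Monic) (hN : f.natDegree = N) :
    f ∣ (Lm N f ρ).charpoly.comp ρ := by
  have h := Matrix.aeval_self_charpoly (Lm N f ρ)
  rw [← AdjoinRoot.mk_eq_zero]
  set χ := (Lm N f ρ).charpoly with hχ
  rw [Lm_eq N f ρ hf hN, aeval_algHom_apply] at h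
  have h2 := Algebra.leftMulMatrix_injective _ (h.trans (map_zero _).symm)
  rw [← h2, comp_eq_aeval]
  exact (aeval_algHom_apply (AdjoinRoot.mkₐ f) ρ χ).symm

lemma norm_root [Nontrivial A] (N : ℕ) (f : A[X]) (hf : f.Monic) (hN : f.natDegree = N) :
    Algebra.norm A (AdjoinRoot.mk f X) = (-1) ^ N * f.coeff 0 := by
  have h := Lm_charpoly N f X hf hN
  rw [comp_X] at h
  have h2 := eq_of_monic_of_dvd_of_natDegree_le hf (Matrix.charpoly_monic _) h (by simp [hN])
  rw [← Lm_det N f X hf hN, Matrix.det_eq_sign_charpoly_coeff, h2]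
  simp

lemma charpoly_rho [Nontrivial A] (N : ℕ) (f : A[X]) (hf : f.Monic) (hN : f.natDegree = N)
    (x y : A) : ∃ s : A, (Lm N f (rho x y)).charpoly.coeff 0 = s ^ 2 * f.coeff 0 := by
  refine ⟨Algebra.norm A (AdjoinRoot.mk f ((X - C x) * (X - C y))), ?_⟩
  have h := Lm_det N f (rho x y) hf hN
  rw [Matrix.det_eq_sign_charpoly_coeff, rho, map_mul, map_mul, norm_root N f hf hN, map_pow,
    map_pow, ← rho, Fintype.card_fin] at h
  have e : ((-1 : A) ^ N) * (-1) ^ N = 1 := by rw [← mul_pow]; simp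
  linear_combination (-1 : A) ^ N * h - ((Lm N f (rho x y)).charpoly.coeff 0
    - Algebra.norm A (AdjoinRoot.mk f ((X - C x) * (X - C y))) ^ 2 * f.coeff 0) * e

lemma quot_eq (f : A[X]) (x : A) : (X - C x) * (f /ₘ (X - C x)) = f - C (f.eval x) := by
  have h := modByMonic_add_div f (X - C x)
  rw [modByMonic_X_sub_C_eq_C_eval] at h
  linear_combination h

lemma rho_uu {m : ℕ} (M : Matrix (Fin m) (Fin m) A) (f : A[X]) (v : Fin m → A[X]) (x y : A)
    (hv : f ∣ X * pq M v - 1) :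
    f ∣ rho x y * pq M (uu f v x y) - C ((f.eval x * f.eval y) ^ 2) := by
  have : uu f v x y = fun i => ((f /ₘ (X - C x)) * (f /ₘ (X - C y))) * v i := rfl
  rw [this, pq_smul, rho]
  obtain ⟨c, hc⟩ := hv
  have hx := quot_eq f x
  have hy := quot_eq f y
  have e : ((X - C x) * (X - C y)) ^ 2 * X *
      ((f /ₘ (X - C x) * (f /ₘ (X - C y))) ^ 2 * pq M v)
      = ((f - C (f.eval x)) * (f - C (f.eval y))) ^ 2 * (f * c + 1) := by
    rw [← hx, ← hy]
    linear_combination (((X - C x) * (X - C y)) ^ 2 *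
      ((f /ₘ (X - C x) * (f /ₘ (X - C y))) ^ 2)) * hc
  rw [e, map_pow, map_mul]
  refine ⟨((f - C (f.eval x)) * (f - C (f.eval y))) ^ 2 * c +
    (f - C (f.eval x) - C (f.eval y)) *
    (((f - C (f.eval x)) * (f - C (f.eval y))) + C (f.eval x) * C (f.eval y)), by ring⟩

lemma Phi_dvd [Nontrivial A] {m : ℕ} (N : ℕ) (M : Matrix (Fin m) (Fin m) A) (f : A[X])
    (v : Fin m → A[X]) (x y : A) (hf : f.Monic) (hN : f.natDegree = N)
    (hv : f ∣ X * pq M v - 1) : f ∣ (Phi N M f v x y).comp (rho x y) := by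
  rw [Phi, sub_comp, mul_comp, X_comp, C_comp, pq_comp]
  have h1 := pq_dvd M f (fun i => (om N f v x y i).comp (rho x y))
    (fun i => C (Pm N f (rho x y)).det * uu f v x y i)
    (fun i => sol_spec N f (rho x y) (uu f v x y i) hf hN)
  rw [pq_smul] at h1
  have h2 := rho_uu M f v x y hv
  have h3 := dvd_add (h1.mul_left (rho x y)) (h2.mul_left (C (Pm N f (rho x y)).det ^ 2))
  convert h3 using 1
  simp only [map_pow, map_mul]
  ring

lemma charpoly_dvd_Phi [Nontrivial A] {m : ℕ} (N : ℕ) (M : Matrix (Fin m) (Fin m) A) (f : A[X])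
    (v : Fin m → A[X]) (x y : A) (hf : f.Monic) (hN : f.natDegree = N)
    (hv : f ∣ X * pq M v - 1) (hD : IsUnit (Pm N f (rho x y)).det) :
    (Lm N f (rho x y)).charpoly ∣ Phi N M f v x y := by
  set F := (Lm N f (rho x y)).charpoly with hF
  have hFm : F.Monic := Matrix.charpoly_monic _
  have hFN : F.natDegree = N := by simp [hF]
  rw [← modByMonic_eq_zero_iff_dvd hFm]
  refine comp_inj N f (rho x y) _ hf hD ?_ ?_
  · rw [← hFN, ← degree_eq_natDegree hFm.ne_zero]; exact degree_modByMonic_lt _ hFm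
  · have e : Phi N M f v x y %ₘ F = Phi N M f v x y - F * (Phi N M f v x y /ₘ F) := by
      rw [modByMonic_eq_sub_mul_div]
    rw [e, sub_comp, mul_comp]
    exact dvd_sub (Phi_dvd N M f v x y hf hN hv) ((Lm_charpoly N f _ hf hN).mul_right _)

lemma om_natDegree {m : ℕ} (n : ℕ) (f : A[X]) (v : Fin m → A[X]) (x y : A) (i : Fin m) :
    (om (n + 1) f v x y i).natDegree ≤ n := by
  have h := sol_degree (n + 1) f (rho x y) (uu f v x y i)
  by_cases h0 : om (n + 1) f v x y i = 0
  · rw [h0]; simp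
  · exact Nat.lt_succ_iff.1 ((natDegree_lt_iff_degree_lt h0).2 h)

lemma pq_natDegree {m : ℕ} (n : ℕ) (M : Matrix (Fin m) (Fin m) A) (w : Fin m → A[X])
    (h : ∀ i, (w i).natDegree ≤ n) : (pq M w).natDegree ≤ 2 * n := by
  refine natDegree_sum_le_of_forall_le _ _ fun i _ => natDegree_sum_le_of_forall_le _ _ fun j _ => ?_
  rw [mul_assoc]
  refine (natDegree_C_mul_le _ _).trans (natDegree_mul_le.trans ?_)
  have := h i
  have := h j
  omega

lemma pq_coeff {m : ℕ} (n : ℕ) (M : Matrix (Fin m) (Fin m) A) (w : Fin m → A[X])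
    (h : ∀ i, (w i).natDegree ≤ n) : (pq M w).coeff (2 * n) =
      ∑ i, ∑ j, M i j * (w i).coeff n * (w j).coeff n := by
  simp only [pq, finsetSum_coeff]
  refine Finset.sum_congr rfl fun i _ => Finset.sum_congr rfl fun j _ => ?_
  rw [mul_assoc, coeff_C_mul, two_mul, coeff_mul_add_eq_of_natDegree_le (h i) (h j), mul_assoc]

lemma Phi_natDegree {m : ℕ} (n : ℕ) (M : Matrix (Fin m) (Fin m) A) (f : A[X])
    (v : Fin m → A[X]) (x y : A) : (Phi (n + 1) M f v x y).natDegree ≤ 2 * n + 1 := by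
  refine (natDegree_sub_le _ _).trans (max_le ?_ (by rw [natDegree_C]; omega))
  refine natDegree_mul_le.trans ?_
  have := pq_natDegree n M _ (om_natDegree n f v x y)
  have := natDegree_X_le (R := A)
  omega

lemma Phi_coeff {m : ℕ} (n : ℕ) (M : Matrix (Fin m) (Fin m) A) (f : A[X])
    (v : Fin m → A[X]) (x y : A) : (Phi (n + 1) M f v x y).coeff (2 * n + 1) =
      ∑ i, ∑ j, M i j * (om (n + 1) f v x y i).coeff n * (om (n + 1) f v x y j).coeff n := by
  rw [Phi, coeff_sub, coeff_X_mul, pq_coeff n M _ (om_natDegree n f v x y), coeff_C_succ, sub_zero]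

lemma HH_natDegree [Nontrivial A] {m : ℕ} (n : ℕ) (M : Matrix (Fin m) (Fin m) A) (f : A[X])
    (v : Fin m → A[X]) (x y : A) : (HH (n + 1) M f v x y).natDegree ≤ n := by
  rw [HH, natDegree_divByMonic _ (Matrix.charpoly_monic _)]
  have := Phi_natDegree n M f v x y
  simp
  omega

/-- output of the construction over a ring where `GG` is a unit -/
lemma step [Nontrivial A] {m : ℕ} (n : ℕ) (M : Matrix (Fin m) (Fin m) A) (f : A[X])
    (v : Fin m → A[X]) (x y : A) (hf : f.Monic) (hN : f.natDegree = n + 1)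
    (hv : f ∣ X * pq M v - 1) (hG : IsUnit (GG n M f v x y))
    (hx : IsUnit (f.eval x)) (hy : IsUnit (f.eval y)) :
    ∃ (h : A[X]) (w : Fin m → A[X]) (z : Fin m → A) (c d s : A), h.Monic ∧ h.Separable ∧
      h.natDegree = n ∧ h ∣ X * pq M w - 1 ∧ IsUnit c ∧ IsUnit d ∧
      c = ∑ i, ∑ j, M i j * z i * z j ∧
      c * h.coeff 0 * (s ^ 2 * f.coeff 0) = - d ^ 2 := by
  rw [GG] at hG
  have hR := isUnit_of_mul_isUnit_right hG
  have hDc := isUnit_of_mul_isUnit_left hG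
  have hD := isUnit_of_mul_isUnit_left hDc
  have hc := isUnit_of_mul_isUnit_right hDc
  have hdv := charpoly_dvd_Phi (n + 1) M f v x y hf hN hv hD
  have hdeg := HH_natDegree n M f v x y
  set H := HH (n + 1) M f v x y with hH
  set F := (Lm (n + 1) f (rho x y)).charpoly with hF
  have hFm : F.Monic := Matrix.charpoly_monic _
  have hFN : F.natDegree = n + 1 := by simp [hF]
  have hmul : F * H = Phi (n + 1) M f v x y := by
    have h0 := modByMonic_add_div (Phi (n + 1) M f v x y) F
    rwa [(modByMonic_eq_zero_iff_dvd hFm).2 hdv, zero_add] at h0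
  obtain ⟨s, hs⟩ := charpoly_rho (n + 1) f hf hN x y
  obtain ⟨c, hcc⟩ := hc
  have hcinv : (↑c⁻¹ : A) * H.coeff n = 1 := by rw [← hcc]; simp
  set d := (Pm (n + 1) f (rho x y)).det * (f.eval x * f.eval y) with hd
  have hdu : IsUnit d := hD.mul (hx.mul hy)
  obtain ⟨d', hd'⟩ := hdu
  have hhm : (C (↑c⁻¹ : A) * H).Monic := by
    refine monic_of_natDegree_le_of_coeff_eq_one n ((natDegree_C_mul_le _ _).trans hdeg) ?_
    rw [coeff_C_mul, hcinv]
  have hhn : (C (↑c⁻¹ : A) * H).natDegree = n := by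
    refine le_antisymm ((natDegree_C_mul_le _ _).trans hdeg) (le_natDegree_of_ne_zero ?_)
    rw [coeff_C_mul, hcinv]; exact one_ne_zero
  have hCu : IsUnit (C (↑c⁻¹ : A)) := (c⁻¹.isUnit).map C
  refine ⟨C (↑c⁻¹ : A) * H, fun i => C (↑d'⁻¹ : A) * om (n + 1) f v x y i,
    fun i => (om (n + 1) f v x y i).coeff n, c, d, s, hhm, ?_, hhn, ?_, c.isUnit,
    ⟨d', hd'⟩, ?_, ?_⟩
  · rcases Nat.eq_zero_or_pos n with rfl | hn
    · rw [eq_one_of_monic_natDegree_zero hhm hhn]; exact separable_one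
    · obtain ⟨p, q, -, -, e⟩ := exists_mul_add_mul_eq_C_resultant H H.derivative hdeg
        ((natDegree_derivative_le H).trans ((Nat.sub_le _ _).trans hdeg)) (Or.inl hn.ne')
      have hcop : IsCoprime H H.derivative := by
        obtain ⟨r, hr⟩ := hR
        refine ⟨C (↑r⁻¹ : A) * p, C (↑r⁻¹ : A) * q, ?_⟩
        have : C (↑r⁻¹ : A) * C (r : A) = 1 := by rw [← C_mul]; simp
        rw [← hr] at e
        linear_combination C (↑r⁻¹ : A) * e + this
      rw [Separable, derivative_C_mul]
      exact (isCoprime_mul_unit_left_left hCu _ _).2 ((isCoprime_mul_unit_left_right hCu _ _).2 hcop)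
  · rw [pq_smul, hCu.mul_left_dvd]
    refine ⟨C (↑d'⁻¹ : A) ^ 2 * F, ?_⟩
    have e2 : C (↑d'⁻¹ : A) * C d = 1 := by rw [← C_mul, ← hd']; simp
    have e3 : H * (C (↑d'⁻¹ : A) ^ 2 * F) = C (↑d'⁻¹ : A) ^ 2 * Phi (n + 1) M f v x y := by
      rw [← hmul]; ring
    rw [e3, Phi, ← hd, map_pow]
    linear_combination (C (↑d'⁻¹ : A) * C d + 1) * e2
  · rw [← Phi_coeff, ← hmul, hcc, two_mul, show n + n + 1 = (n + 1) + n by ring,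
      coeff_mul_add_eq_of_natDegree_le hFN.le hdeg]
    rw [← hFN, hFm.coeff_natDegree, one_mul]
  · have h0 : (F * H).coeff 0 = - d ^ 2 := by
      rw [hmul, Phi, coeff_sub, coeff_X_mul_zero, coeff_C_zero, ← hd, zero_sub]
    rw [← h0, mul_coeff_zero F H, hF, hs, coeff_C_mul]
    have : (c : A) * ↑c⁻¹ = 1 := by simp
    linear_combination H.coeff 0 * s ^ 2 * f.coeff 0 * this

lemma field_G {K : Type*} [Field K] [DecidableEq K] {m : ℕ} (n : ℕ) (M : Matrix (Fin m) (Fin m) K) (f : K[X])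
    (v : Fin m → K[X]) (Z : Finset K) (hZ : f = ∏ z ∈ Z, (X - C z)) (hcard : Z.card = n + 1)
    (θ y : K) (hθ : θ ∈ Z) (hv : f ∣ X * pq M v - 1) (hy : f.eval y ≠ 0)
    (hinj : ∀ z ∈ Z.erase θ, ∀ w ∈ Z.erase θ, z ≠ w → (rho θ y).eval z ≠ (rho θ y).eval w) :
    GG n M f v θ y ≠ 0 := by
  have hf : f.Monic := by rw [hZ]; exact monic_prod_of_monic _ _ fun z _ => monic_X_sub_C z
  have hN : f.natDegree = n + 1 := by rw [hZ, natDegree_finsetProd_X_sub_C_eq_card, hcard]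
  have hroot : ∀ z ∈ Z, f.eval z = 0 := fun z hz => by
    rw [hZ, eval_prod]; exact Finset.prod_eq_zero hz (by simp)
  have hev : ∀ p : K[X], f ∣ p → ∀ z ∈ Z, p.eval z = 0 := fun p hp z hz =>
    eval_eq_zero_of_dvd_of_eval_eq_zero hp (hroot z hz)
  have hzv : ∀ z ∈ Z, z * (pq M v).eval z = 1 := fun z hz => by
    have := hev _ hv z hz
    simpa [sub_eq_zero] using this
  have hz0 : ∀ z ∈ Z, z ≠ 0 := fun z hz h => by
    have := hzv z hz
    simp [h] at this
  have hzy : ∀ z ∈ Z, z ≠ y := fun z hz h => hy (h ▸ hroot z hz)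
  set e : K → K := fun z => (rho θ y).eval z with he
  have heθ : e θ = 0 := by simp [he, rho]
  have hene : ∀ z ∈ Z.erase θ, e z ≠ 0 := fun z hz => by
    have h1 := Finset.ne_of_mem_erase hz
    have h2 := Finset.mem_of_mem_erase hz
    simp [he, rho, sub_eq_zero, h1, hzy z h2, hz0 z h2]
  have heinj : Set.InjOn e Z := by
    intro z hz w hw hzw
    by_contra hne
    by_cases h1 : z = θ
    · subst h1
      exact hene w (Finset.mem_erase.2 ⟨fun h => hne h.symm, hw⟩) (hzw.symm.trans heθ)
    · by_cases h2 : w = θ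
      · subst h2
        exact hene z (Finset.mem_erase.2 ⟨h1, hz⟩) (hzw.trans heθ)
      · exact hinj z (Finset.mem_erase.2 ⟨h1, hz⟩) w (Finset.mem_erase.2 ⟨h2, hw⟩) hne hzw
  have hD : (Pm (n + 1) f (rho θ y)).det ≠ 0 := by
    intro h
    obtain ⟨c, hc, hPc⟩ := Matrix.exists_mulVec_eq_zero_iff.2 h
    have h1 : f ∣ ∑ j : Fin (n + 1), C (c j) * (rho θ y) ^ (j : ℕ) :=
      dvd_of_coeff (n + 1) f _ hf hN fun i => by rw [key, hPc]; rfl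
    have h2 : (∑ j : Fin (n + 1), C (c j) * X ^ (j : ℕ)) = 0 := by
      refine Polynomial.eq_zero_of_degree_lt_of_eval_index_eq_zero Z heinj ?_ ?_
      · rw [hcard]; exact degree_sum_fin_lt c
      · intro z hz
        have := hev _ h1 z hz
        simpa [eval_finsetSum] using this
    apply hc
    ext j
    have h3 := congrArg (fun p => p.coeff j) h2
    simpa [finsetSum_coeff, coeff_X_pow, Fin.val_inj] using h3
  set E : K[X] := ∏ z ∈ Z.erase θ, (X - C (e z)) with hE
  have hEm : E.Monic := monic_prod_of_monic _ _ fun z _ => monic_X_sub_C _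
  have hEn : E.natDegree = n := by
    rw [hE, natDegree_prod_of_monic _ _ fun z _ => monic_X_sub_C _]
    simp [Finset.card_erase_of_mem hθ, hcard]
  have hEsep : E.Separable := by
    rw [hE]
    refine separable_prod' (fun z hz w hw hne => ?_) fun z _ => separable_X_sub_C
    exact isCoprime_X_sub_C_of_isUnit_sub
      (sub_ne_zero.2 (hinj z hz w hw hne)).isUnit
  have hEdvd : ∀ p : K[X], (∀ z ∈ Z.erase θ, p.eval (e z) = 0) → E ∣ p := fun p hp => by
    refine Finset.prod_dvd_of_coprime (fun z hz w hw hne => ?_) fun z hz => ?_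
    · exact isCoprime_X_sub_C_of_isUnit_sub
        (sub_ne_zero.2 (hinj z hz w hw hne)).isUnit
    · exact dvd_iff_isRoot.2 (hp z hz)
  have hE0 : E.eval 0 ≠ 0 := by
    rw [hE, eval_prod, Finset.prod_ne_zero_iff]
    intro z hz
    simpa using hene z hz
  -- the characteristic polynomial
  set F := (Lm (n + 1) f (rho θ y)).charpoly with hF
  have hFm : F.Monic := Matrix.charpoly_monic _
  have hFN : F.natDegree = n + 1 := by simp [hF]
  have hFz : ∀ z ∈ Z, F.eval (e z) = 0 := fun z hz => by
    have := hev _ (Lm_charpoly (n + 1) f (rho θ y) hf hN) z hz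
    rwa [eval_comp] at this
  have hFE : F = X * E := by
    symm
    refine (eq_of_monic_of_dvd_of_natDegree_le (monic_X.mul hEm) hFm ?_ ?_).symm
    · refine IsCoprime.mul_dvd ?_ ?_ (hEdvd F fun z hz => hFz z (Finset.mem_of_mem_erase hz))
      · rw [hE]
        refine IsCoprime.prod_right fun z hz => ?_
        have := isCoprime_X_sub_C_of_isUnit_sub (R := K) (a := 0) (b := e z)
          (by simpa using hene z hz)
        simpa using this
      · have := hFz θ hθ
        rw [heθ] at this
        rwa [X_dvd_iff, coeff_zero_eq_eval_zero]
    · rw [hFN, monic_X.natDegree_mul hEm, hEn, natDegree_X]; omega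
  -- the interpolating polynomials
  have hom : ∀ i, ∀ z ∈ Z, (om (n + 1) f v θ y i).eval (e z)
      = (Pm (n + 1) f (rho θ y)).det * (uu f v θ y i).eval z := fun i z hz => by
    have := hev _ (sol_spec (n + 1) f (rho θ y) (uu f v θ y i) hf hN) z hz
    rw [eval_sub, eval_comp, sub_eq_zero] at this
    simpa [om] using this
  have hgz : ∀ x z : K, (z - x) * (f /ₘ (X - C x)).eval z = f.eval z - f.eval x := fun x z => by
    have := congrArg (eval z) (quot_eq f x)
    simpa using this
  have hom' : ∀ i, ∃ a : K, om (n + 1) f v θ y i = C a * E := fun i => by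
    obtain ⟨g, hg⟩ := hEdvd (om (n + 1) f v θ y i) fun z hz => by
      have hzZ := Finset.mem_of_mem_erase hz
      rw [hom i z hzZ, uu]
      have h1 := hgz θ z
      rw [hroot z hzZ, hroot θ hθ, sub_zero] at h1
      have h2 : (f /ₘ (X - C θ)).eval z = 0 :=
        (mul_eq_zero.1 h1).resolve_left (sub_ne_zero.2 (Finset.ne_of_mem_erase hz))
      simp [h2]
    by_cases hg0 : g = 0
    · exact ⟨0, by simp [hg, hg0]⟩
    have h3 := om_natDegree n f v θ y i
    rw [hg, hEm.natDegree_mul' hg0, hEn] at h3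
    have h4 : g.natDegree = 0 := by omega
    rw [natDegree_eq_zero] at h4
    obtain ⟨a, rfl⟩ := h4
    exact ⟨a, by rw [hg, mul_comm]⟩
  choose a ha using hom'
  have hpqE : pq M (om (n + 1) f v θ y) = E ^ 2 * C (∑ i, ∑ j, M i j * a i * a j) := by
    have : om (n + 1) f v θ y = fun i => E * C (a i) := funext fun i => by rw [ha, mul_comm]
    rw [this, pq_smul, pq]
    simp [map_sum]
  set qa := ∑ i, ∑ j, M i j * a i * a j with hqa
  have hqa0 : qa ≠ 0 := by
    have h1 : (pq M (om (n + 1) f v θ y)).eval 0 ≠ 0 := by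
      have h2 : (pq M (om (n + 1) f v θ y)).eval 0 = ((Pm (n + 1) f (rho θ y)).det *
          ((f /ₘ (X - C θ)).eval θ * (f /ₘ (X - C y)).eval θ)) ^ 2 * (pq M v).eval θ := by
        have h3 : ∀ i, (om (n + 1) f v θ y i).eval 0 = ((Pm (n + 1) f (rho θ y)).det *
          ((f /ₘ (X - C θ)).eval θ * (f /ₘ (X - C y)).eval θ)) * (v i).eval θ := fun i => by
          have := hom i θ hθ
          rw [heθ] at this
          rw [this, uu]; simp only [eval_mul]; ring
        simp only [pq, eval_finsetSum, eval_mul, eval_C, h3, Finset.mul_sum]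
        refine Finset.sum_congr rfl fun i _ => Finset.sum_congr rfl fun j _ => by ring
      rw [h2]
      refine mul_ne_zero (pow_ne_zero _ (mul_ne_zero hD (mul_ne_zero ?_ ?_))) ?_
      · have h5 : f = (X - C θ) * ∏ z ∈ Z.erase θ, (X - C z) := by
          rw [hZ, Finset.mul_prod_erase _ (fun z => X - C z) hθ]
        have h6 : f /ₘ (X - C θ) = ∏ z ∈ Z.erase θ, (X - C z) := by
          conv_lhs => rw [h5]
          exact mul_divByMonic_cancel_left _ (monic_X_sub_C θ)
        rw [h6, eval_prod, Finset.prod_ne_zero_iff]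
        intro z hz
        simpa [sub_eq_zero] using (Finset.ne_of_mem_erase hz).symm
      · intro h
        have h1 := hgz y θ
        rw [h, hroot θ hθ] at h1
        apply hy
        simpa using h1.symm
      · intro h
        have := hzv θ hθ
        simp [h] at this
    intro h
    rw [hpqE, h] at h1
    simp at h1
  have hHE : HH (n + 1) M f v θ y = C qa * E := by
    rw [HH, ← hF, Phi, hpqE, hroot θ hθ]
    have : X * (E ^ 2 * C qa) - C (((Pm (n + 1) f (rho θ y)).det * (0 * f.eval y)) ^ 2)
      = F * (C qa * E) := by
      rw [hFE]; simp; ring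
    rw [this, mul_divByMonic_cancel_left _ hFm]
  have hCu : IsUnit (C qa) := (hqa0.isUnit).map C
  have hdeg : (C qa * E).natDegree = n := by rw [natDegree_C_mul hqa0, hEn]
  have hco : (C qa * E).coeff n = qa := by
    rw [coeff_C_mul, ← hEn, hEm.coeff_natDegree, mul_one]
  rw [GG, hHE]
  refine mul_ne_zero (mul_ne_zero hD (by rwa [hco])) ?_
  have hcop : IsCoprime (C qa * E) (C qa * E).derivative := by
    rw [derivative_C_mul]
    exact (isCoprime_mul_unit_left_left hCu _ _).2
      ((isCoprime_mul_unit_left_right hCu _ _).2 hEsep)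
  have hr := resultant_ne_zero _ _ hcop
  rw [hdeg] at hr
  have hle : (C qa * E).derivative.natDegree ≤ n :=
    (natDegree_derivative_le _).trans ((Nat.sub_le _ _).trans hdeg.le)
  obtain ⟨k, hk⟩ := Nat.exists_eq_add_of_le hle
  have h9 := resultant_add_right_deg (C qa * E) (C qa * E).derivative n _ k le_rfl
  rw [← hk] at h9
  rw [h9, hco]
  exact mul_ne_zero (pow_ne_zero _ hqa0) hr

lemma exists_xy {R : Type u} [CommRing R] [IsLocalRing R] [Infinite (IsLocalRing.ResidueField R)]
    {m : ℕ} (n : ℕ) (M : Matrix (Fin m) (Fin m) R) (f : R[X])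
    (v : Fin m → R[X]) (hf : f.Monic) (hsep : f.Separable) (hN : f.natDegree = n + 1)
    (hv : f ∣ X * pq M v - 1) :
    ∃ x y : R, IsUnit (GG n M f v x y) ∧ IsUnit (f.eval x) ∧ IsUnit (f.eval y) := by
  classical
  let k := IsLocalRing.ResidueField R
  let K := AlgebraicClosure k
  let κ : R →+* k := IsLocalRing.residue R
  let ι : k →+* K := algebraMap k K
  have hι : Function.Injective ι := ι.injective
  have hκ : Function.Surjective κ := IsLocalRing.residue_surjective
  let ψ : R →+* K := ι.comp κ
  have hunit : ∀ r : R, ψ r ≠ 0 → IsUnit r := fun r hr => by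
    have h1 : κ r ≠ 0 := fun h => hr (by simp [ψ, h])
    exact (IsLocalRing.residue_ne_zero_iff_isUnit r).1 h1
  -- a nonzero polynomial over `K` does not vanish on all of `R`
  have hex : ∀ p : K[X], p ≠ 0 → ∃ r : R, p.eval (ψ r) ≠ 0 := fun p hp => by
    by_contra! hall
    apply hp
    refine Polynomial.eq_zero_of_infinite_isRoot p (Set.Infinite.mono ?_
      (Set.infinite_range_of_injective hι))
    rintro _ ⟨a, rfl⟩
    obtain ⟨r, rfl⟩ := hκ a
    exact hall r
  set fK := f.map ψ with hfK
  have hfKm : fK.Monic := hf.map ψ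
  have hfKsep : fK.Separable := hsep.map
  set Z := fK.roots.toFinset with hZd
  have hnd : fK.roots.Nodup := nodup_roots hfKsep
  have hspl : fK.Splits := IsAlgClosed.splits fK
  have hZ : fK = ∏ z ∈ Z, (X - C z) := by
    rw [Finset.prod, hZd, Multiset.toFinset_val, hnd.dedup]
    exact hspl.eq_prod_roots_of_monic hfKm
  have hcard : Z.card = n + 1 := by
    have h1 : fK.natDegree = n + 1 := by rw [hfK, hf.natDegree_map, hN]
    rw [hZ, natDegree_finsetProd_X_sub_C_eq_card] at h1
    exact h1
  obtain ⟨θ, hθ⟩ : Z.Nonempty := Finset.card_pos.1 (by omega)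
  have hvK : fK ∣ X * pq (M.map ψ) (fun i => (v i).map ψ) - 1 := by
    have := Polynomial.map_dvd ψ hv
    simpa [pq_map] using this
  have hroot : ∀ z ∈ Z, fK.eval z = 0 := fun z hz => by
    rw [hZ, eval_prod]; exact Finset.prod_eq_zero hz (by simp)
  have hz0 : ∀ z ∈ Z, z ≠ 0 := fun z hz h => by
    have := eval_eq_zero_of_dvd_of_eval_eq_zero hvK (hroot z hz)
    simp [h] at this
  -- choice of `y`
  let b : K → K → K[X] := fun z w =>
    C ((z - θ) ^ 2 * z) * (C z - X) ^ 2 - C ((w - θ) ^ 2 * w) * (C w - X) ^ 2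
  have hb : ∀ z w y, (b z w).eval y = (rho θ y).eval z - (rho θ y).eval w := fun z w y => by
    simp [b, rho]; ring
  have hb0 : ∀ z ∈ Z.erase θ, ∀ w ∈ Z.erase θ, z ≠ w → b z w ≠ 0 := fun z _ w hw hne h => by
    have h1 : (b z w).eval z = 0 := by rw [h, eval_zero]
    have h2 := Finset.ne_of_mem_erase hw
    have h3 := hz0 w (Finset.mem_of_mem_erase hw)
    simp [b, sub_eq_zero, h2, h3, hne.symm] at h1
  obtain ⟨y, hy⟩ := hex (fK * ∏ z ∈ Z.erase θ, ∏ w ∈ (Z.erase θ).erase z, b z w) (by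
    refine mul_ne_zero hfKm.ne_zero (Finset.prod_ne_zero_iff.2 fun z hz =>
      Finset.prod_ne_zero_iff.2 fun w hw => ?_)
    exact hb0 z hz w (Finset.mem_of_mem_erase hw) (Finset.ne_of_mem_erase hw).symm)
  rw [eval_mul] at hy
  have hy1 := left_ne_zero_of_mul hy
  have hy2 := right_ne_zero_of_mul hy
  simp only [eval_prod] at hy2
  have hG := field_G n (M.map ψ) fK (fun i => (v i).map ψ) Z hZ hcard θ (ψ y) hθ hvK hy1 (by
    intro z hz w hw hne
    have h1 := Finset.prod_ne_zero_iff.1 (Finset.prod_ne_zero_iff.1 hy2 z hz) w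
      (Finset.mem_erase.2 ⟨hne.symm, hw⟩)
    rw [hb] at h1
    exact sub_ne_zero.1 h1)
  -- the generic construction
  set G : R[X] := GG n (M.map C) (f.map C) (fun i => (v i).map C) X (C y) with hGdef
  have hGmap : ∀ (L : Type u) [CommRing L] (φ : R →+* L) (x : L), eval₂ φ x G
      = GG n (M.map φ) (f.map φ) (fun i => (v i).map φ) x (φ y) := by
    intro L _ φ x
    have h1 := GG_map (eval₂RingHom φ x) n (M.map C) (f.map C) (fun i => (v i).map C) X (C y)
      (hf.map C)
    have h2 : (eval₂RingHom φ x).comp C = φ := by ext; simp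
    have h3 : (M.map C).map (eval₂RingHom φ x) = M.map φ := by ext; simp
    rw [h3] at h1
    simp only [Polynomial.map_map, h2, coe_eval₂RingHom, eval₂_X, eval₂_C] at h1
    exact h1
  have hG0 : G.map ψ ≠ 0 := fun h => by
    apply hG
    rw [← hGmap K ψ θ, ← eval_map, h, eval_zero]
  obtain ⟨x, hx⟩ := hex (fK * G.map ψ) (mul_ne_zero hfKm.ne_zero hG0)
  rw [eval_mul] at hx
  refine ⟨x, y, hunit _ ?_, hunit _ ?_, hunit _ ?_⟩
  · have h1 := hGmap R (RingHom.id R) x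
    have h2 : GG n M f v x y = G.eval x := by
      rw [Polynomial.eval, h1]
      simp
    rw [h2, ← eval_map_apply]
    exact right_ne_zero_of_mul hx
  · have := left_ne_zero_of_mul hx
    rwa [hfK, eval_map_apply] at this
  · rwa [hfK, eval_map_apply] at hy1

lemma main_aux {R : Type u} [CommRing R] [IsLocalRing R] [Infinite (IsLocalRing.ResidueField R)]
    {m : ℕ} (M : Matrix (Fin m) (Fin m) R) (Dq : Subgroup Rˣ)
    (hDq : ∀ (w : Rˣ) (z : Fin m → R), (w : R) = ∑ i, ∑ j, M i j * z i * z j → w ∈ Dq) (n : ℕ) :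
    ∀ (f : R[X]) (v : Fin m → R[X]), f.Monic → f.Separable → f.natDegree = n →
    f ∣ X * pq M v - 1 → ∃ u : Rˣ, (u : R) = (-1) ^ n * f.coeff 0 ∧ u ∈ Dq := by
  induction n with
  | zero =>
    intro f v hf _ hN _
    refine ⟨1, ?_, one_mem _⟩
    rw [eq_one_of_monic_natDegree_zero hf hN]; simp
  | succ n ih =>
    intro f v hf hsep hN hv
    obtain ⟨x, y, hG, hx, hy⟩ := exists_xy n M f v hf hsep hN hv
    obtain ⟨h, w, z, c, d, s, hhm, hhs, hhn, hhd, hc, hd, hcz, e⟩ :=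
      step n M f v x y hf hN hv hG hx hy
    obtain ⟨u', hu', hu'D⟩ := ih h w hhm hhs hhn hhd
    obtain ⟨c, rfl⟩ := hc
    obtain ⟨d, rfl⟩ := hd
    have hcD : c ∈ Dq := hDq c z hcz
    have hsq : ∀ a : Rˣ, a ^ 2 ∈ Dq := fun a => by
      have h1 : a ^ 2 * c ∈ Dq := hDq _ (fun i => a * z i) (by
        push_cast
        rw [hcz, Finset.mul_sum]
        refine Finset.sum_congr rfl fun i _ => ?_
        rw [Finset.mul_sum]
        refine Finset.sum_congr rfl fun j _ => by ring)
      simpa using mul_mem h1 (inv_mem hcD)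
    have e2 : ((c : R) * u' * s ^ 2) * ((-1) ^ (n + 1) * f.coeff 0) = (d : R) ^ 2 := by
      have e1 : ((-1 : R) ^ n) * (-1) ^ n = 1 := by rw [← mul_pow]; simp
      rw [hu']
      linear_combination (-(-1 : R) ^ n * (-1) ^ n) * e + (d : R) ^ 2 * e1
    have hs : IsUnit s := by
      have h1 : IsUnit (((c : R) * u' * s ^ 2) * ((-1) ^ (n + 1) * f.coeff 0)) := by
        rw [e2]; exact d.isUnit.pow 2
      have h2 := isUnit_of_mul_isUnit_right (isUnit_of_mul_isUnit_left h1)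
      exact (isUnit_pow_iff two_ne_zero).1 h2
    obtain ⟨s, rfl⟩ := hs
    refine ⟨(c * u' * s ^ 2)⁻¹ * d ^ 2, ?_, mul_mem (inv_mem (mul_mem (mul_mem hcD hu'D) (hsq s)))
      (hsq d)⟩
    rw [Units.val_mul, Units.val_pow_eq_pow_val, ← e2]
    have : ((c : R) * u' * (s : R) ^ 2) = ((c * u' * s ^ 2 : Rˣ) : R) := by push_cast; rfl
    rw [this, Units.inv_mul_cancel_left]
end
end PR

theorem proprel {R : Type u} [CommRing R] [IsLocalRing R] [Invertible (2 : R)]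
    [Infinite (IsLocalRing.ResidueField R)]
    {m n : ℕ} (hn : 0 < n) (M : Matrix (Fin m) (Fin m) R) (hM : M.IsSymm)
    (f : R[X]) (hf : f.Monic) (hsep : f.Separable) (hdeg : f.natDegree = n)
    (hα : IsUnit (AdjoinRoot.root f))
    (v : Fin m → AdjoinRoot f)
    (hv : AdjoinRoot.root f * matrixQF M (AdjoinRoot f) v = 1) :
    ∃ u : Rˣ, (u : R) = Algebra.norm R (matrixQF M (AdjoinRoot f) v) ∧
      u ∈ Subgroup.closure {w : Rˣ | ∃ x : Fin m → R, matrixQF M R x = (w : R)} := by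
  have hex : ∀ i, ∃ p : R[X], AdjoinRoot.mk f p = v i := fun i => AdjoinRoot.mk_surjective (v i)
  choose p hp using hex
  have hq : AdjoinRoot.mk f (PR.pq M p) = matrixQF M (AdjoinRoot f) v := by
    simp only [PR.pq, matrixQF, map_sum, map_mul, hp, AdjoinRoot.mk_C, AdjoinRoot.algebraMap_eq]
  have hd : f ∣ X * PR.pq M p - 1 := by
    rw [← AdjoinRoot.mk_eq_zero, map_sub, map_mul, hq, AdjoinRoot.mk_X, hv, map_one, sub_self]
  obtain ⟨u, hu, huD⟩ := PR.main_aux M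
    (Subgroup.closure {w : Rˣ | ∃ x : Fin m → R, matrixQF M R x = (w : R)})
    (fun w z h => Subgroup.subset_closure ⟨z, by rw [h]; simp [matrixQF]⟩) n f p hf hsep hdeg hd
  refine ⟨u⁻¹, ?_, inv_mem huD⟩
  have h1 := PR.norm_root n f hf hdeg
  rw [← hu, AdjoinRoot.mk_X] at h1
  have h2 := congrArg (Algebra.norm R) hv
  rw [map_mul, h1, map_one] at h2
  exact (left_inv_eq_right_inv (by rw [Units.inv_mul]) h2)
end
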